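/- arXiv:2602.21605 — 10 statements merged into one kernel-verified Lean document; each statement's English description precedes it below -/
import Mathlib

section
/- Let R be a commutative ring, f ∈ R, and φ : M → N a homomorphism of f-torsion-free R-modules. Then the following are equivalent: (1) the induced homomorphism M/fM → N/fN is injective; (2) the commutative square with top map φ : M → N, bottom map φ_f : M[1/f] → N[1/f] (the localization of φ at f), and vertical maps the canonical injections M → M[1/f] and N → N[1/f], is cartesian, i.e., an element x ∈ M[1/f] whose image φ_f(x) lies in the image of N → N[1/f] already lies in the image of M → M[1/f]. -/
/-- An `R`-module `M` is `f`-torsion free if the only element killed by a positive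
power of `f` is zero. -/
def ModuleFTorsionFree {R : Type*} [CommRing R] (f : R) (M : Type*)
    [AddCommGroup M] [Module R M] : Prop :=
  ∀ x : M, (∃ n : ℕ, 1 ≤ n ∧ f ^ n • x = 0) → x = 0

theorem ModuleFTorsionFree.eq_of_pow_smul_eq {R : Type*} [CommRing R] {f : R} {M : Type*}
    [AddCommGroup M] [Module R M] (hM : ModuleFTorsionFree f M) {k : ℕ} {a b : M}
    (h : f ^ k • a = f ^ k • b) : a = b := by
  refine sub_eq_zero.mp (hM _ ⟨k + 1, by lia, ?_⟩)
  rw [pow_succ', mul_smul, smul_sub (f ^ k), h, sub_self, smul_zero]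

theorem ModuleFTorsionFree.mkLinearMap_injective {R : Type*} [CommRing R] {f : R} {M : Type*}
    [AddCommGroup M] [Module R M] (hM : ModuleFTorsionFree f M) :
    Function.Injective (LocalizedModule.mkLinearMap (Submonoid.powers f) M) := by
  intro a b hab
  obtain ⟨⟨_, k, rfl⟩, hc⟩ := IsLocalizedModule.exists_of_eq (S := Submonoid.powers f) hab
  exact hM.eq_of_pow_smul_eq hc

/-- If `φ` is injective modulo `f` and `N` is `f`-torsion free, then `φ` is injective modulo
every power of `f`. -/
theorem ModuleFTorsionFree.exists_eq_pow_smul {R : Type*} [CommRing R] {f : R} {M N : Type*}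
    [AddCommGroup M] [Module R M] [AddCommGroup N] [Module R N] {φ : M →ₗ[R] N}
    (hN : ModuleFTorsionFree f N)
    (hφ : ∀ m : M, (∃ n : N, φ m = f • n) → ∃ m' : M, m = f • m') (k : ℕ) {m : M} {n : N}
    (h : φ m = f ^ k • n) : ∃ m' : M, m = f ^ k • m' := by
  induction k generalizing m with
  | zero => exact ⟨m, by simp⟩
  | succ k ih =>
    rw [pow_succ', mul_smul] at h
    obtain ⟨m₁, rfl⟩ := hφ m ⟨_, h⟩
    rw [map_smul] at h
    obtain ⟨m', rfl⟩ := ih (hN.eq_of_pow_smul_eq (k := 1) (by simpa using h))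
    exact ⟨m', by rw [pow_succ', mul_smul]⟩

/-- For a homomorphism `φ : M → N` of `f`-torsion-free `R`-modules,
the induced map `M/fM → N/fN` is injective iff the square formed by `φ`, its
localization `φ_f : M[1/f] → N[1/f]` and the canonical injections is cartesian. -/
theorem stmt0 {R : Type*} [CommRing R] (f : R) {M N : Type*}
    [AddCommGroup M] [Module R M] [AddCommGroup N] [Module R N]
    (φ : M →ₗ[R] N)
    (hM : ModuleFTorsionFree f M) (hN : ModuleFTorsionFree f N) :
    -- (1) the induced map `M/fM → N/fN` is injective
    (∀ m : M, (∃ n : N, φ m = f • n) → ∃ m' : M, m = f • m') ↔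
    -- (2) the square is cartesian
      (∀ x : LocalizedModule (Submonoid.powers f) M,
        (∃ n : N, LocalizedModule.mkLinearMap (Submonoid.powers f) N n =
            IsLocalizedModule.map (Submonoid.powers f)
              (LocalizedModule.mkLinearMap (Submonoid.powers f) M)
              (LocalizedModule.mkLinearMap (Submonoid.powers f) N) φ x) →
        ∃ m : M, LocalizedModule.mkLinearMap (Submonoid.powers f) M m = x) := by
  constructor
  · rintro hφ x ⟨n, hn⟩
    obtain ⟨⟨m, ⟨_, k, rfl⟩⟩, hx⟩ := IsLocalizedModule.surj (Submonoid.powers f)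
      (LocalizedModule.mkLinearMap (Submonoid.powers f) M) x
    change f ^ k • x = LocalizedModule.mkLinearMap (Submonoid.powers f) M m at hx
    have hm : φ m = f ^ k • n := by
      apply hN.mkLinearMap_injective
      rw [map_smul, hn, ← map_smul, hx, IsLocalizedModule.map_apply]
    obtain ⟨m', rfl⟩ := hN.exists_eq_pow_smul hφ k hm
    refine ⟨m', IsLocalizedModule.smul_injective
      (LocalizedModule.mkLinearMap (Submonoid.powers f) M)
      (⟨f ^ k, k, rfl⟩ : Submonoid.powers f) ?_⟩
    change f ^ k • LocalizedModule.mkLinearMap (Submonoid.powers f) M m' = f ^ k • x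
    rw [hx, map_smul]
  · rintro h m ⟨n, hn⟩
    let s : Submonoid.powers f := ⟨f, Submonoid.mem_powers f⟩
    have hs : f • IsLocalizedModule.mk' (LocalizedModule.mkLinearMap (Submonoid.powers f) M) m s =
        LocalizedModule.mkLinearMap (Submonoid.powers f) M m :=
      IsLocalizedModule.mk'_cancel' _ m s
    obtain ⟨m', hm'⟩ := h (IsLocalizedModule.mk' _ m s) ⟨n, by
      apply IsLocalizedModule.smul_injective
        (LocalizedModule.mkLinearMap (Submonoid.powers f) N) s
      change f • LocalizedModule.mkLinearMap (Submonoid.powers f) N n =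
        f • IsLocalizedModule.map (Submonoid.powers f) _ _ φ _
      rw [← map_smul, ← map_smul, hs, IsLocalizedModule.map_apply, hn]⟩
    refine ⟨m', hM.mkLinearMap_injective ?_⟩
    rw [map_smul, hm', hs]
end

section
/- Let φ : A → B be a homomorphism of commutative rings such that A and B are f-torsion free for an element f ∈ A. Then the following are equivalent: (1) the induced ring homomorphism A/fA → B/fB is injective; (2) the commutative square of rings with top map φ : A → B, bottom map φ_f : A[1/f] → B[1/f], and vertical maps the canonical injections, is cartesian, i.e., φ_f^{-1}(B) = A (an element x ∈ A[1/f] with φ_f(x) in the image of B → B[1/f] lies in the image of A → A[1/f]). -/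
/-- A ring `A` is `f`-torsion free if the only element killed by a positive power
of `f` is zero. -/
def FTorsionFree {A : Type*} [CommRing A] (f : A) : Prop :=
  ∀ x : A, (∃ n : ℕ, 1 ≤ n ∧ f ^ n * x = 0) → x = 0

/-- The canonical map to the localization away from `f` is injective on an `f`-torsion
free ring. -/
theorem FTorsionFree.algebraMap_injective {A : Type*} [CommRing A] {f : A}
    (hA : FTorsionFree f) :
    Function.Injective (algebraMap A (Localization.Away f)) := by
  rw [injective_iff_map_eq_zero]
  intro x hx
  obtain ⟨⟨_, n, rfl⟩, hn⟩ := (IsLocalization.map_eq_zero_iff (Submonoid.powers f) _ x).1 hx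
  refine hA x ⟨n + 1, Nat.le_add_left 1 n, ?_⟩
  rw [pow_succ', mul_assoc]
  exact mul_eq_zero_of_right f hn

theorem Localization.awayMap_algebraMap {A B : Type*} [CommRing A] [CommRing B]
    (φ : A →+* B) (f a : A) :
    Localization.awayMap φ f (algebraMap A (Localization.Away f) a) =
      algebraMap B (Localization.Away (φ f)) (φ a) :=
  IsLocalization.map_eq _ a

/-- If divisibility by `φ f` descends to divisibility by `f`, then so does divisibility by
powers, provided that `φ f` is not a zero divisor. -/
theorem FTorsionFree.exists_eq_pow_mul {A B : Type*} [CommRing A] [CommRing B] {φ : A →+* B}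
    {f : A} (hB : FTorsionFree (φ f))
    (h : ∀ a : A, (∃ b : B, φ a = φ f * b) → ∃ a' : A, a = f * a')
    (n : ℕ) (a : A) (b : B) (hab : φ a = φ f ^ n * b) : ∃ a' : A, a = f ^ n * a' := by
  induction n generalizing a with
  | zero => exact ⟨a, by simp⟩
  | succ n ih =>
    obtain ⟨c, rfl⟩ := h a ⟨φ f ^ n * b, by rw [hab]; ring⟩
    have hc : φ c = φ f ^ n * b := by
      refine sub_eq_zero.1 (hB _ ⟨1, le_rfl, ?_⟩)
      rw [map_mul] at hab
      linear_combination hab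
    obtain ⟨a', rfl⟩ := ih c hc
    exact ⟨a', by ring⟩

/-- For a ring homomorphism `φ : A → B` with `A` and `B`
`f`-torsion free, the induced map `A/fA → B/fB` is injective iff the square formed
by `φ`, its localization `φ_f : A[1/f] → B[1/f]` and the canonical injections is
cartesian, i.e. `φ_f⁻¹(B) = A`. -/
theorem stmt1 {A B : Type*} [CommRing A] [CommRing B] (φ : A →+* B) (f : A)
    (hA : FTorsionFree f) (hB : FTorsionFree (φ f)) :
    -- (1) the induced map `A/fA → B/fB` is injective
    (∀ a : A, (∃ b : B, φ a = φ f * b) → ∃ a' : A, a = f * a') ↔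
    -- (2) the square is cartesian
      (∀ x : Localization.Away f,
        (∃ b : B, algebraMap B (Localization.Away (φ f)) b = Localization.awayMap φ f x) →
        ∃ a : A, algebraMap A (Localization.Away f) a = x) := by
  have hf : IsUnit (algebraMap A (Localization.Away f) f) :=
    IsLocalization.Away.algebraMap_isUnit f
  have hφf : IsUnit (algebraMap B (Localization.Away (φ f)) (φ f)) :=
    IsLocalization.Away.algebraMap_isUnit (φ f)
  constructor
  · rintro h x ⟨b, hb⟩
    obtain ⟨n, a, ha⟩ := IsLocalization.Away.surj f x
    have hab : φ a = φ f ^ n * b := by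
      apply hB.algebraMap_injective
      rw [← Localization.awayMap_algebraMap, ← ha, map_mul, map_pow,
        Localization.awayMap_algebraMap, ← hb, map_mul, map_pow, mul_comm]
    obtain ⟨a', rfl⟩ := hB.exists_eq_pow_mul h n a b hab
    refine ⟨a', (hf.pow n).mul_left_cancel ?_⟩
    rw [mul_comm _ x, ha, map_mul, map_pow]
  · rintro h a ⟨b, hb⟩
    obtain ⟨x, hx⟩ := hf.dvd (a := algebraMap A (Localization.Away f) a)
    obtain ⟨a', rfl⟩ := h x ⟨b, hφf.mul_left_cancel <| by
      rw [← map_mul, ← hb, ← Localization.awayMap_algebraMap, hx, map_mul,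
        Localization.awayMap_algebraMap]⟩
    exact ⟨a', hA.algebraMap_injective (by rw [hx, map_mul])⟩
end

section
/- Let A be a commutative ring, f ∈ A a non-zero-divisor, and φ : A → Â the f-adic completion of A. Then: (1) Â is f-torsion free; (2) the square with top map φ, bottom map φ_f : A[1/f] → Â[1/f], and vertical canonical injections is cartesian (i.e., φ_f^{-1}(Â) = A); (3) A is completely integrally closed in A[1/f] if and only if Â is completely integrally closed in Â[1/f]. -/
/-- `b : B` is almost integral over `A` (along `φ : A → B`): all powers of `b`
lie in the `A`-span of some finite subset of `B`. -/
def AlmostIntegralElem {A B : Type*} [CommRing A] [CommRing B] (φ : A →+* B)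
    (b : B) : Prop :=
  ∃ s : Finset B, ∀ n : ℕ, ∃ c : B → A, b ^ n = ∑ x ∈ s, φ (c x) * x

/-- `A` is completely integrally closed in `B` (along `φ : A → B`). -/
def CompletelyIntegrallyClosedIn {A B : Type*} [CommRing A] [CommRing B]
    (φ : A →+* B) : Prop :=
  ∀ b : B, AlmostIntegralElem φ b → ∃ a : A, φ a = b

open IsLocalization in
lemma almostIntegralElem_iff_of_isLocalizationAway {R S : Type*} [CommRing R] [CommRing S]
    [Algebra R S] (r : R) [IsLocalization.Away r S] (b : S) :
    AlmostIntegralElem (algebraMap R S) b ↔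
      ∃ k : ℕ, ∀ n : ℕ, ∃ a : R, algebraMap R S a = algebraMap R S r ^ k * b ^ n := by
  constructor
  · rintro ⟨s, hs⟩
    obtain ⟨⟨_, k, rfl⟩, hk⟩ := exist_integer_multiples_of_finset (Submonoid.powers r) s
    choose! d hd using hk
    refine ⟨k, fun n ↦ ?_⟩
    obtain ⟨c, hc⟩ := hs n
    refine ⟨∑ x ∈ s, c x * d x, ?_⟩
    rw [hc, map_sum, Finset.mul_sum]
    refine Finset.sum_congr rfl fun x hx ↦ ?_
    rw [map_mul, hd x hx, Algebra.smul_def, map_pow]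
    ring
  · rintro ⟨k, hk⟩
    refine ⟨{Away.invSelf r ^ k}, fun n ↦ ?_⟩
    obtain ⟨a, ha⟩ := hk n
    refine ⟨fun _ ↦ a, ?_⟩
    have h : algebraMap R S r ^ k * Away.invSelf r ^ k = 1 := by
      rw [← mul_pow, Away.mul_invSelf, one_pow]
    rw [Finset.sum_singleton, ha]
    linear_combination (-b ^ n) * h

namespace AdicCompletion

variable {A : Type*} [CommRing A] (f : A)

local notation "Â" => AdicCompletion (Ideal.span (singleton f)) A

lemma exists_pow_mul_eq_of_evalₐ_eq_zero {n : ℕ} {x : Â}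
    (hx : evalₐ (Ideal.span {f}) n x = 0) : ∃ y : Â, algebraMap A Â f ^ n * y = x := by
  have hI : (Ideal.span {f} ^ n • ⊤ : Ideal A) = Ideal.span {f} ^ n := by simp
  have hx' : x ∈ (eval (Ideal.span {f}) A n).ker := by
    rw [LinearMap.mem_ker, ← factor_evalₐ_eq_eval (h := hI.ge), hx, _root_.map_zero]
  rw [← pow_smul_top_eq_ker_eval (Submodule.fg_span_singleton f),
    Ideal.span_singleton_pow, Submodule.ideal_span_singleton_smul,
    Submodule.mem_smul_pointwise_iff_exists] at hx'
  obtain ⟨y, -, rfl⟩ := hx'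
  exact ⟨y, by rw [Algebra.smul_def, map_pow]⟩

lemma exists_eq_algebraMap_add_pow_mul (n : ℕ) (x : Â) :
    ∃ (a : A) (y : Â), x = algebraMap A Â a + algebraMap A Â f ^ n * y := by
  obtain ⟨a, ha⟩ := Ideal.Quotient.mk_surjective (evalₐ (Ideal.span {f}) n x)
  obtain ⟨y, hy⟩ := exists_pow_mul_eq_of_evalₐ_eq_zero f (n := n) (x := x - algebraMap A Â a) (by
    rw [map_sub, AlgHom.commutes, ← ha]
    exact sub_self _)
  exact ⟨a, y, by rw [hy]; ring⟩

lemma pow_dvd_of_algebraMap_eq_pow_mul {n : ℕ} {a : A} {y : Â}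
    (h : algebraMap A Â a = algebraMap A Â f ^ n * y) : f ^ n ∣ a := by
  have h' := congrArg (evalₐ (Ideal.span {f}) n) h
  rw [← map_pow, map_mul, AlgHom.commutes, AlgHom.commutes, Ideal.Quotient.algebraMap_eq,
    Ideal.Quotient.eq_zero_iff_mem.2
      (Ideal.pow_mem_pow (Ideal.mem_span_singleton_self f) n), zero_mul,
    Ideal.Quotient.eq_zero_iff_mem, Ideal.span_singleton_pow, Ideal.mem_span_singleton] at h'
  exact h'

variable {f}

lemma algebraMap_mem_nonZeroDivisors (hf : f ∈ nonZeroDivisors A) :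
    algebraMap A Â f ∈ nonZeroDivisors Â := by
  rw [mem_nonZeroDivisors_iff_right]
  intro x hx
  refine ext_evalₐ fun n ↦ ?_
  obtain ⟨a, y, rfl⟩ := exists_eq_algebraMap_add_pow_mul f (n + 1) x
  have h : f ^ (n + 1) ∣ a * f := by
    refine pow_dvd_of_algebraMap_eq_pow_mul f (y := - (y * algebraMap A Â f)) ?_
    rw [map_mul]
    linear_combination hx
  rw [pow_succ] at h
  obtain ⟨b, hb⟩ := h
  obtain rfl : a = f ^ n * b := by
    rw [← sub_eq_zero]
    refine (mem_nonZeroDivisors_iff_right.1 hf) _ ?_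
    linear_combination hb
  have h0 : evalₐ (Ideal.span {f}) n (algebraMap A Â (f ^ n)) = 0 := by
    rw [AlgHom.commutes, Ideal.Quotient.algebraMap_eq, Ideal.Quotient.eq_zero_iff_mem]
    exact Ideal.pow_mem_pow (Ideal.mem_span_singleton_self f) n
  rw [pow_succ, map_add, map_mul (algebraMap A Â), map_mul, mul_assoc, map_mul _ (_ ^ n),
    ← map_pow, h0, zero_mul, zero_mul, add_zero,
    _root_.map_zero]

lemma exists_algebraMap_eq_of_awayMap_eq (hf : f ∈ nonZeroDivisors A) (x : Localization.Away f)
    (b : Â) (hb : algebraMap Â (Localization.Away (algebraMap A Â f)) b =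
      Localization.awayMap (algebraMap A Â) f x) :
    ∃ a : A, algebraMap A (Localization.Away f) a = x := by
  obtain ⟨k, a, ha⟩ := IsLocalization.Away.surj f x
  have hinj := IsLocalization.injective (Localization.Away (algebraMap A Â f))
    (Submonoid.powers_le.2 (algebraMap_mem_nonZeroDivisors hf))
  have h : algebraMap A Â a = algebraMap A Â f ^ k * b := by
    apply hinj
    have h' := congrArg (Localization.awayMap (algebraMap A Â) f) ha
    simp only [map_mul, map_pow, Localization.awayMap, IsLocalization.Away.map,
      IsLocalization.map_eq] at h' hb ⊢
    rw [← h', hb, mul_comm]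
  obtain ⟨c, rfl⟩ := pow_dvd_of_algebraMap_eq_pow_mul f h
  refine ⟨c, ?_⟩
  refine ((IsLocalization.Away.algebraMap_isUnit f).pow k).mul_left_cancel ?_
  rw [mul_comm _ x, ha, map_mul, map_pow]

lemma awayMap_algebraMap (a : A) :
    Localization.awayMap (algebraMap A Â) f (algebraMap A (Localization.Away f) a) =
      algebraMap Â (Localization.Away (algebraMap A Â f)) (algebraMap A Â a) :=
  IsLocalization.map_eq _ a

/-- Modulo the image of `Â`, every element of `Â[1/f]` comes from `A[1/f]`. -/
lemma exists_eq_awayMap_add (y : Localization.Away (algebraMap A Â f)) :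
    ∃ (x : Localization.Away f) (c : Â), y = Localization.awayMap (algebraMap A Â) f x +
      algebraMap Â (Localization.Away (algebraMap A Â f)) c := by
  obtain ⟨m, b, hb⟩ := IsLocalization.Away.surj (algebraMap A Â f) y
  obtain ⟨a, c, rfl⟩ := exists_eq_algebraMap_add_pow_mul f m b
  refine ⟨algebraMap A _ a * IsLocalization.Away.invSelf f ^ m, c, ?_⟩
  refine ((IsLocalization.Away.algebraMap_isUnit (algebraMap A Â f)).pow m).mul_left_cancel ?_
  have h := congrArg (fun z ↦ Localization.awayMap (algebraMap A Â) f z ^ m)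
    (IsLocalization.Away.mul_invSelf (S := Localization.Away f) f)
  simp only [map_mul, map_one, one_pow, awayMap_algebraMap, mul_pow] at h
  rw [mul_comm _ y, hb]
  simp only [map_mul, map_pow, map_add, awayMap_algebraMap]
  linear_combination (-algebraMap Â (Localization.Away (algebraMap A Â f)) (algebraMap A Â a)) * h

lemma completelyIntegrallyClosedIn_away_iff (hf : f ∈ nonZeroDivisors A) :
    CompletelyIntegrallyClosedIn (algebraMap A (Localization.Away f)) ↔
      CompletelyIntegrallyClosedIn
        (algebraMap Â (Localization.Away (algebraMap A Â f))) := by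
  constructor
  · intro H y hy
    obtain ⟨x, c, rfl⟩ := exists_eq_awayMap_add y
    rw [almostIntegralElem_iff_of_isLocalizationAway (algebraMap A Â f)] at hy
    obtain ⟨k, hk⟩ := hy
    choose d hd using hk
    obtain ⟨a, rfl⟩ := H x <| by
      rw [almostIntegralElem_iff_of_isLocalizationAway f]
      refine ⟨k, fun n ↦ exists_algebraMap_eq_of_awayMap_eq hf _
        (∑ i ∈ Finset.range (n + 1), d i * (-c) ^ (n - i) * n.choose i) ?_⟩
      rw [map_mul, map_pow, map_pow, awayMap_algebraMap, ← add_neg_cancel_right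
        (Localization.awayMap (algebraMap A Â) f x) (algebraMap Â _ c), add_pow, map_sum,
        Finset.mul_sum]
      refine Finset.sum_congr rfl fun i _ ↦ ?_
      simp only [map_mul, map_pow, map_neg, map_natCast, hd]
      ring
    exact ⟨algebraMap A Â a + c, by rw [map_add, awayMap_algebraMap]⟩
  · intro H x hx
    rw [almostIntegralElem_iff_of_isLocalizationAway f] at hx
    obtain ⟨k, hk⟩ := hx
    obtain ⟨b, hb⟩ := H (Localization.awayMap (algebraMap A Â) f x) <| by
      rw [almostIntegralElem_iff_of_isLocalizationAway (algebraMap A Â f)]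
      refine ⟨k, fun n ↦ ?_⟩
      obtain ⟨a, ha⟩ := hk n
      refine ⟨algebraMap A Â a, ?_⟩
      rw [← awayMap_algebraMap, ha, map_mul, map_pow, map_pow, awayMap_algebraMap]
    exact exists_algebraMap_eq_of_awayMap_eq hf x b hb

end AdicCompletion

/-- Let `f ∈ A` be a non-zero-divisor and `φ : A → Â` the
`f`-adic completion of `A`. Then (1) `Â` is `f`-torsion free, (2) the square
formed by `φ`, `φ_f : A[1/f] → Â[1/f]` and the canonical injections is cartesian,
and (3) `A` is completely integrally closed in `A[1/f]` iff `Â` is completely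
integrally closed in `Â[1/f]`. -/
theorem stmt7 {A : Type*} [CommRing A] (f : A) (hf : f ∈ nonZeroDivisors A) :
    -- (1) `Â` is `f`-torsion free
    (∀ x : AdicCompletion (Ideal.span {f}) A,
      (∃ n : ℕ, 1 ≤ n ∧ (algebraMap A (AdicCompletion (Ideal.span {f}) A) f) ^ n * x = 0) →
      x = 0) ∧
    -- (2) the square is cartesian: `φ_f⁻¹(Â) = A`
    (∀ x : Localization.Away f,
      (∃ b : AdicCompletion (Ideal.span {f}) A,
        algebraMap (AdicCompletion (Ideal.span {f}) A)
            (Localization.Away (algebraMap A (AdicCompletion (Ideal.span {f}) A) f)) b =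
          Localization.awayMap (algebraMap A (AdicCompletion (Ideal.span {f}) A)) f x) →
      ∃ a : A, algebraMap A (Localization.Away f) a = x) ∧
    -- (3) complete integral closedness transfers both ways
    (CompletelyIntegrallyClosedIn (algebraMap A (Localization.Away f)) ↔
      CompletelyIntegrallyClosedIn
        (algebraMap (AdicCompletion (Ideal.span {f}) A)
          (Localization.Away (algebraMap A (AdicCompletion (Ideal.span {f}) A) f)))) := by
  refine ⟨fun x ⟨n, _, hx⟩ ↦ ?_, fun x ⟨b, hb⟩ ↦ ?_, ?_⟩
  · exact (mem_nonZeroDivisors_iff_left.1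
      (pow_mem (AdicCompletion.algebraMap_mem_nonZeroDivisors hf) n)) x hx
  · exact AdicCompletion.exists_algebraMap_eq_of_awayMap_eq hf x b hb
  · exact AdicCompletion.completelyIntegrallyClosedIn_away_iff hf
end

section
/- Fix a prime p. Let A be a commutative ring and I ⊆ A an ideal containing p such that A is I-adically complete (Hausdorff and complete for the I-adic topology). Let lim_{x↦x^p} A denote the multiplicative monoid of sequences (a_n)_{n≥0} in A with a_{n+1}^p = a_n for all n, let A^♭ = lim_Frob A/pA denote the inverse limit of copies of A/pA along the Frobenius endomorphism x ↦ x^p, and let lim_Frob A/I denote the inverse limit of copies of A/I along Frobenius. Then the natural maps (given by componentwise reduction) lim_{x↦x^p} A → A^♭ and lim_{x↦x^p} A → lim_Frob A/I are bijective, and are isomorphisms of multiplicative monoids; moreover the inverse of the second map sends a compatible sequence (x_n mod I)_{n≥0} to (lim_{n→∞} x_{n+m}^{p^n})_{m≥0}. -/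
/-- The multiplicative monoid of `p`-power-compatible sequences in `A`:
sequences `(a_n)` with `a_{n+1}^p = a_n` for all `n`, under componentwise
multiplication. For `A = R/pR` this is the tilt `R^♭` (the transition maps are
the Frobenius `x ↦ x^p`). -/
def pthPowerLim (p : ℕ) (A : Type*) [CommMonoid A] : Submonoid (ℕ → A) where
  carrier := {a | ∀ n, a (n + 1) ^ p = a n}
  mul_mem' := by
    intro a b ha hb n
    simp only [Pi.mul_apply, mul_pow, ha n, hb n]
  one_mem' := by intro n; simp

/-- An adically complete ring is complete with respect to every principal ideal contained in the
ideal of definition. -/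
theorem IsAdicComplete.span_singleton {A : Type*} [CommRing A] {I : Ideal A} [IsAdicComplete I A]
    {a : A} (ha : a ∈ I) : IsAdicComplete (Ideal.span {a}) A where
  haus' x hx := by
    refine IsHausdorff.haus' (I := I) x fun n ↦ (hx n).mono ?_
    exact Submodule.smul_mono_left
      (Ideal.pow_right_mono ((Ideal.span_singleton_le_iff_mem I).mpr ha) n)
  prec' f hf := by
    have hstep (n : ℕ) : ∃ c, f (n + 1) = f n + a ^ n * c := by
      have h := SModEq.sub_mem.mp (hf n.le_succ).symm
      rw [smul_eq_mul, Ideal.mul_top, Ideal.span_singleton_pow, Ideal.mem_span_singleton] at h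
      obtain ⟨c, hc⟩ := h
      exact ⟨c, by rw [← hc]; ring⟩
    choose c hc using hstep
    have hsum (n m : ℕ) :
        f (n + m) = f n + a ^ n * ∑ j ∈ Finset.range m, a ^ j * c (n + j) := by
      induction m with
      | zero => simp
      | succ m ih => rw [← add_assoc, hc, ih, Finset.sum_range_succ]; ring
    have hlim (n : ℕ) : ∃ S, ∀ m, ∑ j ∈ Finset.range m, a ^ j * c (n + j) ≡ S
        [SMOD (I ^ m • ⊤ : Ideal A)] := by
      refine IsPrecomplete.prec' _ (AdicCompletion.AdicCauchySequence.mk I A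
        (fun m ↦ ∑ j ∈ Finset.range m, a ^ j * c (n + j)) fun m ↦ ?_).2
      rw [SModEq.comm, SModEq.sub_mem, Finset.sum_range_succ, add_sub_cancel_left, smul_eq_mul,
        Ideal.mul_top]
      exact Ideal.mul_mem_right _ _ (Ideal.pow_mem_pow ha m)
    choose S hS using hlim
    have hS_eq (n : ℕ) : S 0 = f n + a ^ n * S n - f 0 := by
      refine (IsHausdorff.eq_iff_smodEq (I := I)).mpr fun m ↦ ?_
      have h₀ : ∑ j ∈ Finset.range (n + m), a ^ j * c (0 + j) = f (n + m) - f 0 := by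
        have := hsum 0 (n + m)
        rw [zero_add] at this
        rw [this]; ring
      have h₁ := (hS 0 (n + m)).symm.mono
        (Submodule.smul_mono_left (Ideal.pow_le_pow_right (Nat.le_add_left m n)))
      rw [h₀, hsum n m] at h₁
      exact h₁.trans ((SModEq.rfl.add ((hS n m).smul (a ^ n))).sub SModEq.rfl)
    refine ⟨f 0 + S 0, fun n ↦ ?_⟩
    rw [SModEq.comm, SModEq.sub_mem, smul_eq_mul, Ideal.mul_top, Ideal.span_singleton_pow,
      Ideal.mem_span_singleton]
    exact ⟨S n, by rw [hS_eq n]; ring⟩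

namespace pthPowerLim

variable {p : ℕ} {A : Type*} [CommRing A] {I : Ideal A}

theorem apply_add_pow {M : Type*} [CommMonoid M] (a : pthPowerLim p M) (n m : ℕ) :
    a.1 (n + m) ^ p ^ n = a.1 m := by
  induction n with
  | zero => simp
  | succ n ih => rw [pow_succ', pow_mul, Nat.add_right_comm, a.2, ih]

variable (p) in
/-- Componentwise application of a monoid homomorphism. -/
def map {M N : Type*} [CommMonoid M] [CommMonoid N] (f : M →* N) :
    pthPowerLim p M →* pthPowerLim p N where
  toFun a := ⟨fun n ↦ f (a.1 n), fun n ↦ by rw [← map_pow, a.2]⟩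
  map_one' := Subtype.ext <| funext fun _ ↦ map_one f
  map_mul' _ _ := Subtype.ext <| funext fun _ ↦ map_mul f _ _

theorem smodEq_pow_of_mk_eq (hpI : (p : A) ∈ I) (a : pthPowerLim p A) {x : ℕ → A}
    (hx : ∀ n, Ideal.Quotient.mk I (x n) = Ideal.Quotient.mk I (a.1 n)) (n m : ℕ) :
    a.1 m ≡ x (n + m) ^ p ^ n [SMOD I ^ (n + 1)] := by
  rw [← apply_add_pow a n m]
  exact .pow_pow_add_one hpI (SModEq.idealQuotientMk.mpr (hx _).symm) n

theorem map_mk_injective [IsHausdorff I A] (hpI : (p : A) ∈ I) :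
    Function.Injective (map p (Ideal.Quotient.mk I : A →* A ⧸ I)) := by
  intro a b hab
  refine Subtype.ext <| funext fun m ↦ (IsHausdorff.eq_iff_smodEq (I := I)).mpr fun n ↦ ?_
  rw [smul_eq_mul, Ideal.mul_top, ← apply_add_pow b n m]
  refine (smodEq_pow_of_mk_eq hpI a (x := b.1) (fun k ↦ ?_) n m).mono
    (Ideal.pow_le_pow_right n.le_succ)
  exact (congrFun (congrArg Subtype.val hab) k).symm

theorem map_mk_surjective [IsAdicComplete I A] (hpI : (p : A) ∈ I) :
    Function.Surjective (map p (Ideal.Quotient.mk I : A →* A ⧸ I)) := by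
  intro y
  choose x hx using fun n ↦ Ideal.Quotient.mk_surjective (y.1 n)
  have hxp (n : ℕ) : x (n + 1) ^ p ≡ x n [SMOD I] := by
    rw [SModEq.idealQuotientMk, map_pow, hx, hx, y.2]
  have hstep (m n : ℕ) : x (n + m) ^ p ^ n ≡ x (n + 1 + m) ^ p ^ (n + 1) [SMOD I ^ (n + 1)] := by
    rw [pow_succ' p, pow_mul, Nat.add_right_comm]
    exact .pow_pow_add_one hpI (hxp _).symm n
  have hlim (m : ℕ) : ∃ L, ∀ n, x (n + m) ^ p ^ n ≡ L [SMOD (I ^ n • ⊤ : Ideal A)] := by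
    refine IsPrecomplete.prec' _ (AdicCompletion.AdicCauchySequence.mk I A
      (fun n ↦ x (n + m) ^ p ^ n) fun n ↦ ?_).2
    rw [smul_eq_mul, Ideal.mul_top]
    exact (hstep m n).mono (Ideal.pow_le_pow_right n.le_succ)
  choose L hL using hlim
  simp only [smul_eq_mul, Ideal.mul_top] at hL
  refine ⟨⟨L, fun m ↦ (IsHausdorff.eq_iff_smodEq (I := I)).mpr fun n ↦ ?_⟩,
    Subtype.ext <| funext fun m ↦ ?_⟩
  · rw [smul_eq_mul, Ideal.mul_top]
    refine ((hL (m + 1) n).symm.pow p).trans ?_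
    have h := (hL m (n + 1)).mono (Ideal.pow_le_pow_right n.le_succ)
    rwa [pow_succ, pow_mul, add_assoc, add_comm 1 m] at h
  · have h := hL m 1
    rw [pow_one, pow_one, add_comm] at h
    exact (SModEq.idealQuotientMk.mp (h.symm.trans (hxp m))).trans (hx m)

theorem map_mk_bijective [IsAdicComplete I A] (hpI : (p : A) ∈ I) :
    Function.Bijective (map p (Ideal.Quotient.mk I : A →* A ⧸ I)) :=
  ⟨map_mk_injective hpI, map_mk_surjective hpI⟩

end pthPowerLim

/-- Fontaine's lemma. Let `A` be `I`-adically complete with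
`p ∈ I`. Then the natural componentwise-reduction maps
`lim_{x ↦ x^p} A → A^♭ = lim_Frob A/pA` and `lim_{x ↦ x^p} A → lim_Frob A/I` are
bijective isomorphisms of multiplicative monoids; moreover the inverse of the
second map sends a compatible sequence `(x_n mod I)` to `(lim_{n → ∞} x_{n+m}^{p^n})_m`
(the limit being taken in the `I`-adic topology). -/
theorem stmt9 (p : ℕ) (hp : p.Prime) (A : Type*) [CommRing A] (I : Ideal A)
    (hpI : (p : A) ∈ I) (hcomplete : IsAdicComplete I A) :
    ∃ (F1 : pthPowerLim p A →* pthPowerLim p (A ⧸ Ideal.span {(p : A)}))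
      (F2 : pthPowerLim p A →* pthPowerLim p (A ⧸ I)),
      -- `F1` and `F2` are the natural maps, given by componentwise reduction
      (∀ (a : pthPowerLim p A) (n : ℕ),
        (F1 a).1 n = Ideal.Quotient.mk (Ideal.span {(p : A)}) (a.1 n)) ∧
      (∀ (a : pthPowerLim p A) (n : ℕ),
        (F2 a).1 n = Ideal.Quotient.mk I (a.1 n)) ∧
      -- they are bijective (hence monoid isomorphisms)
      Function.Bijective F1 ∧ Function.Bijective F2 ∧
      -- the inverse of `F2` is given by `(x_n mod I)_n ↦ (lim_n x_{n+m}^{p^n})_m`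
      (∀ (a : pthPowerLim p A) (x : ℕ → A),
        (∀ n, Ideal.Quotient.mk I (x n) = (F2 a).1 n) →
        ∀ (m k : ℕ), ∃ N : ℕ, ∀ n ≥ N, a.1 m - x (n + m) ^ p ^ n ∈ I ^ k) := by
  have hcomplete_p : IsAdicComplete (Ideal.span {(p : A)}) A := .span_singleton hpI
  refine ⟨pthPowerLim.map p (Ideal.Quotient.mk (Ideal.span {(p : A)}) : A →* _),
    pthPowerLim.map p (Ideal.Quotient.mk I : A →* _), fun _ _ ↦ rfl, fun _ _ ↦ rfl,
    pthPowerLim.map_mk_bijective (Ideal.mem_span_singleton_self _),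
    pthPowerLim.map_mk_bijective hpI, fun a x hx m k ↦ ⟨k, fun n hn ↦ ?_⟩⟩
  exact SModEq.sub_mem.mp <| (pthPowerLim.smodEq_pow_of_mk_eq hpI a hx n m).mono <|
    Ideal.pow_le_pow_right (hn.trans n.le_succ)
end

section
/- Fix a prime p and let A be a p-adically complete commutative ring. Then the map from the set of idempotents of A to the set of idempotents of A^♭ = lim_Frob A/pA sending an idempotent e ∈ A to the constant compatible sequence (e mod p, e mod p, e mod p, …) is a bijection. In particular, A has no nontrivial idempotents if and only if A^♭ has no nontrivial idempotents. -/
/-- Two idempotents that agree modulo an ideal contained in the Jacobson radical are equal. -/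
theorem IsIdempotentElem.eq_of_quotient_mk_eq {A : Type*} [CommRing A] {I : Ideal A}
    (hI : I ≤ Ideal.jacobson ⊥) {e f : A} (he : IsIdempotentElem e) (hf : IsIdempotentElem f)
    (h : Ideal.Quotient.mk I e = Ideal.Quotient.mk I f) : e = f := by
  have hef : e - f ∈ I := Ideal.Quotient.eq.mp h
  have hu : IsUnit ((e - f) * (-(e - f)) + 1) := Ideal.mem_jacobson_bot.mp (hI hef) _
  have hmul : (e - f) * ((e - f) * (-(e - f)) + 1) = 0 := by
    have he' : e * e = e := he
    have hf' : f * f = f := hf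
    linear_combination (3 * f - e - 1) * he' + (f - 3 * e + 1) * hf'
  exact sub_eq_zero.mp ((hu.mul_left_eq_zero).mp hmul)

/-- Idempotents lift along the quotient by a Henselian ideal. -/
theorem HenselianRing.exists_isIdempotentElem_quotient_mk_eq {A : Type*} [CommRing A]
    (I : Ideal A) [HenselianRing A I] {x : A ⧸ I} (hx : IsIdempotentElem x) :
    ∃ e : A, IsIdempotentElem e ∧ Ideal.Quotient.mk I e = x := by
  obtain ⟨a, rfl⟩ := Ideal.Quotient.mk_surjective x
  have ha : a * a - a ∈ I := Ideal.Quotient.eq.mp ((map_mul _ a a).trans hx)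
  have hmonic : (Polynomial.X ^ 2 - Polynomial.X : Polynomial A).Monic :=
    Polynomial.monic_X_pow_sub (Polynomial.degree_X_le.trans_lt (by norm_num))
  have hderiv : IsUnit (Ideal.Quotient.mk I
      ((Polynomial.X ^ 2 - Polynomial.X : Polynomial A).derivative.eval a)) := by
    refine IsUnit.of_mul_eq_one (Ideal.Quotient.mk I (2 * a - 1)) ?_
    rw [← map_mul, ← map_one (Ideal.Quotient.mk I), Ideal.Quotient.eq]
    convert I.mul_mem_left 4 ha using 1
    simp
    ring
  obtain ⟨e, he, hea⟩ := HenselianRing.is_henselian (I := I) _ hmonic a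
    (by simpa [pow_two] using ha) hderiv
  refine ⟨e, ?_, Ideal.Quotient.eq.mpr hea⟩
  have he' : e ^ 2 - e = 0 := by simpa using he
  exact (pow_two e).symm.trans (sub_eq_zero.mp he')

/-- A `p`-power-compatible sequence of idempotents is constant. -/
theorem eq_apply_zero_of_pow_eq_of_isIdempotentElem {M : Type*} [Monoid M] {p : ℕ} (hp : p ≠ 0)
    {b : ℕ → M} (hb : ∀ n, b (n + 1) ^ p = b n) (hi : ∀ n, IsIdempotentElem (b n)) (n : ℕ) :
    b n = b 0 := by
  induction n with
  | zero => rfl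
  | succ n ih => rw [← ih, ← hb n, (hi (n + 1)).pow_eq hp]

/-- Let `A` be a `p`-adically complete commutative ring. The
map sending an idempotent `e ∈ A` to the constant compatible sequence
`(e mod p, e mod p, …) ∈ A^♭ = lim_Frob A/pA` is a bijection between the
idempotents of `A` and the idempotents of `A^♭`. In particular, `A` has no
nontrivial idempotents iff `A^♭` has no nontrivial idempotents. -/
theorem stmt10 (p : ℕ) (hp : p.Prime) (A : Type*) [CommRing A]
    (hcomplete : IsAdicComplete (Ideal.span {(p : A)}) A) :
    (∃ G : {e : A // IsIdempotentElem e} →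
        {b : pthPowerLim p (A ⧸ Ideal.span {(p : A)}) // IsIdempotentElem b},
      -- `G` sends `e` to the constant sequence `(e mod p, e mod p, …)`
      (∀ (e : {e : A // IsIdempotentElem e}) (n : ℕ),
        (G e).1.1 n = Ideal.Quotient.mk (Ideal.span {(p : A)}) e.1) ∧
      Function.Bijective G) ∧
    -- in particular, `A` has no nontrivial idempotents iff `A^♭` has none
    ((∀ e : A, IsIdempotentElem e → e = 0 ∨ e = 1) ↔
      (∀ b : ℕ → A ⧸ Ideal.span {(p : A)}, (∀ n, b (n + 1) ^ p = b n) →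
        (∀ n, b n * b n = b n) → b = 0 ∨ b = 1)) := by
  have hH : HenselianRing A (Ideal.span {(p : A)}) := inferInstance
  set I := Ideal.span {(p : A)}
  have hinj {e f : A} (he : IsIdempotentElem e) (hf : IsIdempotentElem f)
      (h : Ideal.Quotient.mk I e = Ideal.Quotient.mk I f) : e = f :=
    he.eq_of_quotient_mk_eq hH.jac hf h
  have hsurj {b : ℕ → A ⧸ I} (hb : ∀ n, b (n + 1) ^ p = b n)
      (hi : ∀ n, IsIdempotentElem (b n)) :
      ∃ e : A, IsIdempotentElem e ∧ ∀ n, Ideal.Quotient.mk I e = b n := by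
    obtain ⟨e, he, heb⟩ := HenselianRing.exists_isIdempotentElem_quotient_mk_eq I (hi 0)
    exact ⟨e, he, fun n ↦
      heb.trans (eq_apply_zero_of_pow_eq_of_isIdempotentElem hp.ne_zero hb hi n).symm⟩
  have hmk {e : A} (he : IsIdempotentElem e) : IsIdempotentElem (Ideal.Quotient.mk I e) :=
    he.map _
  refine ⟨⟨fun e ↦ ⟨⟨fun _ ↦ Ideal.Quotient.mk I e.1, fun _ ↦ (hmk e.2).pow_eq hp.ne_zero⟩,
    Subtype.ext (funext fun _ ↦ hmk e.2)⟩, fun _ _ ↦ rfl, ?_, ?_⟩, ?_, ?_⟩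
  · intro e f h
    exact Subtype.ext (hinj e.2 f.2 (congrArg (fun b ↦ b.1.1 0) h))
  · rintro ⟨⟨b, hb⟩, hi⟩
    obtain ⟨e, he, heb⟩ := hsurj hb fun n ↦ congrFun (congrArg Subtype.val hi) n
    exact ⟨⟨e, he⟩, Subtype.ext (Subtype.ext (funext heb))⟩
  · intro h b hb hi
    obtain ⟨e, he, heb⟩ := hsurj hb hi
    obtain rfl | rfl := h e he
    · exact Or.inl (funext fun n ↦ by simp [← heb n])
    · exact Or.inr (funext fun n ↦ by simp [← heb n])
  · intro h e he
    refine (h (fun _ ↦ Ideal.Quotient.mk I e) (fun _ ↦ (hmk he).pow_eq hp.ne_zero)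
      fun _ ↦ hmk he).imp (fun h0 ↦ ?_) fun h1 ↦ ?_
    · exact hinj he .zero (by simpa using congrFun h0 0)
    · exact hinj he .one (by simpa using congrFun h1 0)
end

section
/- Let R ↪ S be an injective homomorphism of commutative rings and f ∈ R a non-zero-divisor. If R is integrally closed in R[1/f] and every element of S is integral over R, then the induced map R/fR → S/fS is injective (equivalently, fS ∩ R = fR). -/
/-- Let `ι : R ↪ S` be an injective ring map and `f ∈ R` a
non-zero-divisor. If `R` is integrally closed in `R[1/f]` and every element of
`S` is integral over `R`, then the induced map `R/fR → S/fS` is injective,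
i.e. `fS ∩ R = fR`. -/
theorem stmt11 {R S : Type*} [CommRing R] [CommRing S] (ι : R →+* S)
    (hι : Function.Injective ι) (f : R) (hf : f ∈ nonZeroDivisors R)
    -- `R` is integrally closed in `R[1/f]`
    (hic : ∀ x : Localization.Away f,
      (algebraMap R (Localization.Away f)).IsIntegralElem x →
      ∃ r : R, algebraMap R (Localization.Away f) r = x)
    -- `S` is integral over `R`
    (hint : ∀ s : S, ι.IsIntegralElem s) :
    -- `R/fR → S/fS` is injective: `fS ∩ R = fR`
    ∀ r : R, (∃ s : S, ι r = ι f * s) → ∃ r' : R, r = f * r' := by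
  rintro r ⟨s, hs⟩
  obtain ⟨p, hp, hps⟩ := hint s
  have hroot : (p.scaleRoots f).eval r = 0 := by
    apply hι
    rw [← Polynomial.eval₂_at_apply, hs, Polynomial.scaleRoots_eval₂_mul, hps, mul_zero, map_zero]
  have hunit : IsUnit (algebraMap R (Localization.Away f) f) :=
    IsLocalization.Away.algebraMap_isUnit f
  obtain ⟨x, hx⟩ := hunit.dvd (a := algebraMap R (Localization.Away f) r)
  have hpx : p.eval₂ (algebraMap R (Localization.Away f)) x = 0 := by
    rw [← (hunit.pow p.natDegree).mul_right_eq_zero, ← Polynomial.scaleRoots_eval₂_mul, ← hx,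
      Polynomial.eval₂_at_apply, hroot, map_zero]
  obtain ⟨r', hr'⟩ := hic x ⟨p, hp, hpx⟩
  refine ⟨r', IsLocalization.injective (Localization.Away f)
    (Submonoid.powers_le.mpr hf) ?_⟩
  rw [map_mul, hr', hx]
end

section
/- Let {R_i, t_i : R_i → R_{i+1}}_{i≥0} be a tower (ℕ-indexed inductive system) of commutative rings, I ⊆ R_0 an ideal, and suppose that each induced map R_i/IR_i → R_{i+1}/IR_{i+1} is injective. Let R_∞ = colim_i R_i and assume the ideal IR_∞ ⊆ R_∞ is finitely generated. Then for every i ≥ 0, the ring homomorphism R_i/IR_i → (R_∞)^∧/I(R_∞)^∧ induced by the composition R_i → R_∞ → (R_∞)^∧ is injective, where (R_∞)^∧ denotes the I-adic completion of R_∞. -/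
/-- In a colimit of a tower of rings, every element of the extension of an ideal of the bottom
ring comes from the extension of that ideal to some finite level. -/
theorem Ideal.exists_mem_map_of_mem_map_colimit {R : ℕ → Type*} [∀ i, CommRing (R i)]
    {t : ∀ i j, i ≤ j → R i →+* R j}
    (ht_comp : ∀ i j k (hij : i ≤ j) (hjk : j ≤ k) (x : R i),
      t j k hjk (t i j hij x) = t i k (hij.trans hjk) x)
    {L : Type*} [CommRing L] {g : ∀ i, R i →+* L}
    (hg : ∀ i j (hij : i ≤ j) (x : R i), g j (t i j hij x) = g i x)
    (hjointsurj : ∀ a : L, ∃ (i : ℕ) (x : R i), g i x = a)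
    (I : Ideal (R 0)) {z : L} (hz : z ∈ I.map (g 0)) :
    ∃ (j : ℕ) (y : R j), y ∈ I.map (t 0 j (Nat.zero_le j)) ∧ g j y = z := by
  have map_mem : ∀ i j (hij : i ≤ j) (y : R i), y ∈ I.map (t 0 i (Nat.zero_le i)) →
      t i j hij y ∈ I.map (t 0 j (Nat.zero_le j)) := fun i j hij y hy ↦ by
    have h := Ideal.mem_map_of_mem (t i j hij) hy
    rwa [Ideal.map_map, show (t i j hij).comp (t 0 i (Nat.zero_le i)) = t 0 j (Nat.zero_le j) from
      RingHom.ext fun a ↦ ht_comp _ _ _ _ _ a] at h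
  induction hz using Submodule.span_induction with
  | mem z hz =>
    obtain ⟨a, ha, rfl⟩ := hz
    exact ⟨0, t 0 0 le_rfl a, Ideal.mem_map_of_mem _ ha, hg _ _ _ _⟩
  | zero => exact ⟨0, 0, zero_mem _, map_zero _⟩
  | add u v _ _ hu hv =>
    obtain ⟨j, y, hy, rfl⟩ := hu
    obtain ⟨k, w, hw, rfl⟩ := hv
    refine ⟨max j k, t j _ (le_max_left j k) y + t k _ (le_max_right j k) w,
      add_mem (map_mem _ _ _ _ hy) (map_mem _ _ _ _ hw), ?_⟩
    rw [map_add, hg, hg]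
  | smul a u _ hu =>
    obtain ⟨j, y, hy, rfl⟩ := hu
    obtain ⟨k, w, rfl⟩ := hjointsurj a
    refine ⟨max j k, t k _ (le_max_right j k) w * t j _ (le_max_left j k) y,
      Ideal.mul_mem_left _ _ (map_mem _ _ _ _ hy), ?_⟩
    rw [map_mul, hg, hg, smul_eq_mul]

/-- If the algebra map of an element into the adic completion along `J` lies in the extension
of `J`, then the element lies in `J`. -/
theorem AdicCompletion.mem_of_algebraMap_mem_map {A : Type*} [CommRing A] (J : Ideal A) {a : A}
    (ha : algebraMap A (AdicCompletion J A) a ∈ J.map (algebraMap A (AdicCompletion J A))) :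
    a ∈ J := by
  have hle : J.map (algebraMap A (AdicCompletion J A)) ≤
      RingHom.ker (AdicCompletion.evalOneₐ J) := by
    rw [Ideal.map_le_iff_le_comap]
    intro b hb
    rw [Ideal.mem_comap, RingHom.mem_ker, AlgHom.commutes]
    exact Ideal.Quotient.eq_zero_iff_mem.mpr hb
  have h := hle ha
  rw [RingHom.mem_ker, AlgHom.commutes] at h
  exact Ideal.Quotient.eq_zero_iff_mem.mp h


/-- Let `{R_i}` be an ℕ-indexed tower of commutative rings
(presented as an inductive system `t i j : R i →+* R j` for `i ≤ j`), `I ⊆ R_0`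
an ideal such that each induced map `R_i/IR_i → R_{i+1}/IR_{i+1}` is injective.
Let `L = R_∞` be the colimit, and assume the ideal `IL ⊆ L` is finitely
generated. Then for every `i`, the induced map `R_i/IR_i → L^∧/I·L^∧` is
injective, where `L^∧` is the `I`-adic completion of `L`. -/
theorem stmt15 (R : ℕ → Type*) [∀ i, CommRing (R i)]
    (t : ∀ i j, i ≤ j → R i →+* R j)
    (ht_id : ∀ i (x : R i), t i i le_rfl x = x)
    (ht_comp : ∀ i j k (hij : i ≤ j) (hjk : j ≤ k) (x : R i),
      t j k hjk (t i j hij x) = t i k (hij.trans hjk) x)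
    -- `L` is the colimit `R_∞` of the tower, with structure maps `g i`
    (L : Type*) [CommRing L] (g : ∀ i, R i →+* L)
    (hg : ∀ i j (hij : i ≤ j) (x : R i), g j (t i j hij x) = g i x)
    (hjointsurj : ∀ a : L, ∃ (i : ℕ) (x : R i), g i x = a)
    (heqfactor : ∀ i (x y : R i), g i x = g i y →
      ∃ (j : ℕ) (hij : i ≤ j), t i j hij x = t i j hij y)
    (I : Ideal (R 0))
    -- each induced map `R_i/IR_i → R_{i+1}/IR_{i+1}` is injective
    (hinj : ∀ i (x : R i),
      t i (i + 1) (Nat.le_succ i) x ∈ Ideal.map (t 0 (i + 1) (Nat.zero_le _)) I →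
      x ∈ Ideal.map (t 0 i (Nat.zero_le i)) I)
    -- the ideal `I·R_∞` is finitely generated
    (hfg : (Ideal.map (g 0) I).FG) :
    -- `R_i/IR_i → (R_∞)^∧ / I·(R_∞)^∧` is injective
    ∀ i (x : R i),
      algebraMap L (AdicCompletion (Ideal.map (g 0) I) L) (g i x) ∈
        Ideal.map (algebraMap L (AdicCompletion (Ideal.map (g 0) I) L))
          (Ideal.map (g 0) I) →
      x ∈ Ideal.map (t 0 i (Nat.zero_le i)) I := by
  intro i x hx
  have descend : ∀ j (hij : i ≤ j),
      t i j hij x ∈ I.map (t 0 j (Nat.zero_le j)) → x ∈ I.map (t 0 i (Nat.zero_le i)) := by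
    intro j hij
    induction j, hij using Nat.le_induction with
    | base => rw [ht_id]; exact id
    | succ j hij ih =>
      intro h
      rw [← ht_comp i j (j + 1) hij (Nat.le_succ j)] at h
      exact ih (hinj j _ h)
  obtain ⟨j, y, hy, hyx⟩ := Ideal.exists_mem_map_of_mem_map_colimit ht_comp hg hjointsurj I
    (AdicCompletion.mem_of_algebraMap_mem_map _ hx)
  have hm : g (max i j) (t i _ (le_max_left i j) x) = g (max i j) (t j _ (le_max_right i j) y) := by
    rw [hg, hg, hyx]
  obtain ⟨k, hk, h⟩ := heqfactor _ _ _ hm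
  rw [ht_comp, ht_comp] at h
  refine descend k ((le_max_left i j).trans hk) ?_
  rw [h]
  have hy' := Ideal.mem_map_of_mem (t j k ((le_max_right i j).trans hk)) hy
  rwa [Ideal.map_map, show (t j k _).comp (t 0 j (Nat.zero_le j)) = t 0 k (Nat.zero_le k) from
    RingHom.ext fun a ↦ ht_comp _ _ _ _ _ a] at hy'
end

section
/- Let C be a commutative ring and I ⊆ C a finitely generated ideal such that C is I-adically complete, and let B ⊆ C be a subring containing the ideal IC (equivalently, containing I·C as a subset). Then: (1) B is open in C for the I-adic topology; (2) IC is an ideal of the ring B, the subspace topology on B induced from the I-adic topology of C coincides with the IC-adic topology on B, and also with the I·B-adic topology (where I·B is the ideal of B generated by the image of I); (3) B is IC-adically complete (Hausdorff and complete). -/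
namespace Subring

variable {C : Type*} [CommRing C] {I : Ideal C} {B : Subring C}

theorem comap_subtype_pow_succ (hIB : (I : Set C) ⊆ B) (n : ℕ) :
    (I.comap B.subtype) ^ (n + 1) = (I ^ (n + 1)).comap B.subtype := by
  refine le_antisymm (Ideal.le_comap_pow _ _) ?_
  suffices h : ∀ x ∈ I ^ (n + 1), ∃ y ∈ (I.comap B.subtype) ^ (n + 1), (y : C) = x by
    intro b hb
    obtain ⟨y, hy, hyb⟩ := h b hb
    rwa [← Subtype.ext hyb]
  induction n with
  | zero =>
    intro x hx
    rw [zero_add, pow_one] at hx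
    exact ⟨⟨x, hIB hx⟩, by simpa using hx, rfl⟩
  | succ n ih =>
    intro x hx
    rw [pow_succ] at hx
    induction hx using Submodule.mul_induction_on' with
    | mem_mul_mem a ha b hb =>
      obtain ⟨y, hy, rfl⟩ := ih a ha
      refine ⟨y * ⟨b, hIB hb⟩, ?_, rfl⟩
      rw [pow_succ]
      exact Ideal.mul_mem_mul hy hb
    | add a _ b _ ha hb =>
      obtain ⟨y, hy, rfl⟩ := ha
      obtain ⟨z, hz, rfl⟩ := hb
      exact ⟨y + z, add_mem hy hz, rfl⟩

theorem isAdic_comap_subtype [TopologicalSpace C] [IsTopologicalRing C] (hI : IsAdic I)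
    (hIB : (I : Set C) ⊆ B) : IsAdic (I.comap B.subtype) := by
  obtain ⟨hopen, hsmall⟩ := isAdic_iff.mp hI
  refine isAdic_iff.mpr ⟨fun n ↦ ?_, fun s hs ↦ ?_⟩
  · cases n with
    | zero => simp
    | succ n =>
      rw [comap_subtype_pow_succ hIB]
      exact (hopen (n + 1)).preimage continuous_subtype_val
  · obtain ⟨u, hu, hus⟩ := mem_nhds_subtype _ _ _ |>.mp hs
    obtain ⟨n, hn⟩ := hsmall u hu
    exact ⟨n, fun x hx ↦ hus (hn (Ideal.le_comap_pow _ _ hx))⟩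

theorem isOpen_of_isAdic [TopologicalSpace C] [IsTopologicalRing C] (hI : IsAdic I)
    (hIB : (I : Set C) ⊆ B) : IsOpen (B : Set C) := by
  have hopen : IsOpen (I : Set C) := by simpa using (isAdic_iff.mp hI).1 1
  exact B.toAddSubgroup.isOpen_of_mem_nhds (g := 0)
    (Filter.mem_of_superset (hopen.mem_nhds I.zero_mem) hIB)

theorem isAdicComplete_comap_subtype [IsAdicComplete I C] (hIB : (I : Set C) ⊆ B) :
    IsAdicComplete (I.comap B.subtype) B := by
  let : WithIdeal C := ⟨I⟩
  have hI : IsAdic I := rfl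
  obtain ⟨_, _⟩ := hI.isAdicComplete_iff.mp ‹_›
  have hclosed : IsClosed (B : Set C) :=
    B.toAddSubgroup.isClosed_of_isOpen (isOpen_of_isAdic hI hIB)
  have : IsUniformAddGroup B := B.toAddSubgroup.isUniformAddGroup
  exact (isAdic_comap_subtype hI hIB).isAdicComplete_iff.mpr
    ⟨hclosed.completeSpace_coe, inferInstance⟩

end Subring

/-- Let `C` be a commutative ring, `I ⊆ C` a finitely generated
ideal with `C` `I`-adically complete, and `B ⊆ C` a subring containing the ideal
`IC = I` as a subset. Then: (1) `B` is open in `C` for the `I`-adic topology;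
(2) `IC` is an ideal of `B`, and the subspace topology on `B` coincides with the
`IC`-adic topology as well as with the `I·B`-adic topology, where `I·B` is the
ideal of `B` generated by the image of `I`; (3) `B` is `IC`-adically complete. -/
theorem stmt16 {C : Type*} [CommRing C] (I : Ideal C) (hfg : I.FG)
    (hcomplete : IsAdicComplete I C) (B : Subring C)
    (hIB : (I : Set C) ⊆ (B : Set C)) :
    -- (1) `B` is open in `C` for the `I`-adic topology
    (@IsOpen C I.adicTopology (B : Set C)) ∧
    -- (2) `IC` is an ideal of the ring `B` …
    (∃ J : Ideal B, (J : Set B) = Subtype.val ⁻¹' (I : Set C)) ∧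
    -- … the subspace topology on `B` is the `IC`-adic topology …
    (TopologicalSpace.induced (Subtype.val : B → C) I.adicTopology =
      (I.comap B.subtype).adicTopology) ∧
    -- … and also the `I·B`-adic topology
    (TopologicalSpace.induced (Subtype.val : B → C) I.adicTopology =
      (Ideal.span (Subtype.val ⁻¹' (I : Set C)) : Ideal B).adicTopology) ∧
    -- (3) `B` is `IC`-adically complete (Hausdorff and complete)
    IsAdicComplete (I.comap B.subtype) B := by
  let : WithIdeal C := ⟨I⟩
  have hI : IsAdic I := rfl
  have hB : IsAdic (I.comap B.subtype) := Subring.isAdic_comap_subtype hI hIB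
  have hspan : Ideal.span (Subtype.val ⁻¹' (I : Set C)) = I.comap B.subtype :=
    Ideal.span_eq (I.comap B.subtype)
  exact ⟨Subring.isOpen_of_isAdic hI hIB, ⟨I.comap B.subtype, rfl⟩, hB, by rw [hspan]; exact hB,
    Subring.isAdicComplete_comap_subtype hIB⟩
end

section
/- Let A be a commutative ring and I ⊆ A a finitely generated ideal such that A is I-adically complete and the pair (A, I) satisfies the Artin–Rees type condition (APf): for every finitely generated A-module M and every finitely generated A-submodule N ⊆ M, the filtration {N ∩ I^n M}_{n≥0} is I-adic, i.e., there exists c ≥ 0 with N ∩ I^n M = I^{n-c}(N ∩ I^c M) for all n ≥ c. Let F be a flat A-module. Then for every finitely presented A-module M, the canonical map M ⊗_A F^∧ → (M ⊗_A F)^∧ is an isomorphism, where (−)^∧ denotes I-adic completion of A-modules. -/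
universe u

/-- The Artin–Rees type condition **(APf)** for a pair `(A, I)`: for every
finitely generated `A`-module `M` and every finitely generated submodule
`N ⊆ M`, the filtration `{N ∩ IⁿM}ₙ` on `N` is `I`-adic, i.e. there is `c ≥ 0`
with `N ∩ IⁿM = I^(n-c)(N ∩ I^cM)` for all `n ≥ c`. -/
def APf {A : Type u} [CommRing A] (I : Ideal A) : Prop :=
  ∀ (M : Type u) [AddCommGroup M] [Module A M], Module.Finite A M →
    ∀ N : Submodule A M, N.FG →
      ∃ c : ℕ, ∀ n : ℕ, c ≤ n →
        N ⊓ (I ^ n • (⊤ : Submodule A M)) =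
          I ^ (n - c) • (N ⊓ (I ^ c • (⊤ : Submodule A M)))

open scoped TensorProduct

section Flat

variable {A : Type*} [CommRing A] {Q P F : Type*} [AddCommGroup Q] [Module A Q]
  [AddCommGroup P] [Module A P] [AddCommGroup F] [Module A F]

/-- A linear map carries `J • ⊤` into `J • ⊤`. -/
lemma LinearMap.apply_mem_smul_top (J : Ideal A) (f : Q →ₗ[A] P) {x : Q}
    (hx : x ∈ J • (⊤ : Submodule A Q)) : f x ∈ J • (⊤ : Submodule A P) := by
  have h := Submodule.mem_map_of_mem (f := f) hx
  rw [Submodule.map_smul''] at h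
  exact smul_mono_right J (le_top : Submodule.map f ⊤ ≤ ⊤) h

/-- An Artin–Rees inclusion for the range of `f` persists after tensoring with a flat module. -/
lemma Module.Flat.smul_top_inf_range_rTensor_le [Module.Flat A F] (f : Q →ₗ[A] P) (J J' : Ideal A)
    (h : LinearMap.range f ⊓ J • (⊤ : Submodule A P) ≤
      Submodule.map f (J' • (⊤ : Submodule A Q))) :
    J • (⊤ : Submodule A (P ⊗[A] F)) ⊓ LinearMap.range (f.rTensor F) ≤
      Submodule.map (f.rTensor F) (J' • (⊤ : Submodule A (Q ⊗[A] F))) := by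
  rintro _ ⟨hx, t, rfl⟩
  set L : Submodule A P := J • ⊤
  let q : Q →ₗ[A] P ⧸ L := L.mkQ ∘ₗ f
  have hzero : q.rTensor F t = 0 := by
    have hmem := LinearMap.apply_mem_smul_top J (L.mkQ.rTensor F) hx
    have hbot : J • (⊤ : Submodule A ((P ⧸ L) ⊗[A] F)) = ⊥ := by
      rw [eq_bot_iff, Submodule.smul_le]
      intro r hr z hz
      clear hz
      rw [Submodule.mem_bot]
      induction z with
      | zero => simp
      | add a b ha hb => rw [smul_add, ha, hb, add_zero]
      | tmul a b =>
        obtain ⟨p, rfl⟩ := Submodule.Quotient.mk_surjective L a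
        have hp : r • p ∈ L := Submodule.smul_mem_smul hr Submodule.mem_top
        rw [TensorProduct.smul_tmul', ← Submodule.Quotient.mk_smul,
          (Submodule.Quotient.mk_eq_zero L).2 hp, TensorProduct.zero_tmul]
    rw [hbot, Submodule.mem_bot] at hmem
    rw [LinearMap.rTensor_comp_apply]
    exact hmem
  obtain ⟨s, rfl⟩ :=
    (Module.Flat.rTensor_exact F (LinearMap.exact_subtype_ker_map q) t).1 hzero
  clear hzero hx
  induction s with
  | zero => simp
  | add a b ha hb => simpa using Submodule.add_mem _ ha hb
  | tmul d y =>
    have hd : f d ∈ L := by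
      rw [← Submodule.Quotient.mk_eq_zero]
      exact d.2
    obtain ⟨d', hd', hfd⟩ := h ⟨⟨_, rfl⟩, hd⟩
    refine ⟨d' ⊗ₜ y, ?_, by simp [hfd]⟩
    exact LinearMap.apply_mem_smul_top J' ((TensorProduct.mk A Q F).flip y) hd'

end Flat

namespace AdicCompletion

section Exact

variable {A : Type*} [CommRing A] (I : Ideal A) {Q P N : Type*} [AddCommGroup Q] [Module A Q]
  [AddCommGroup P] [Module A P] [AddCommGroup N] [Module A N]

/-- Adic completion preserves right exactness of `Q → P → N → 0` when the image of `Q`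
satisfies an Artin–Rees inclusion. -/
lemma exists_map_eq_of_map_eq_zero (f : Q →ₗ[A] P) (g : P →ₗ[A] N) (hfg : Function.Exact f g)
    (hg : Function.Surjective g) (c : ℕ)
    (hc : ∀ n, c ≤ n → I ^ n • (⊤ : Submodule A P) ⊓ LinearMap.range f ≤
      Submodule.map f (I ^ (n - c) • (⊤ : Submodule A Q)))
    (z : AdicCompletion I P) (hz : map I g z = 0) : ∃ w, map I f w = z := by
  obtain ⟨b, rfl⟩ := mk_surjective I P z
  have approx (n : ℕ) : ∃ y : Q, f y - b n ∈ I ^ n • (⊤ : Submodule A P) := by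
    have hb : g (b n) ∈ I ^ n • (⊤ : Submodule A N) := by
      simpa using congrArg (fun x ↦ x.val n) hz
    have hmap : I ^ n • (⊤ : Submodule A N) = Submodule.map g (I ^ n • ⊤) := by
      rw [Submodule.map_smul'', Submodule.map_top, LinearMap.range_eq_top.2 hg]
    rw [hmap] at hb
    obtain ⟨d, hd, hdb⟩ := hb
    obtain ⟨y, hy⟩ := (hfg (b n - d)).1 (by simp [hdb])
    refine ⟨y, ?_⟩
    rw [hy, sub_sub_cancel_left]
    exact Submodule.neg_mem _ hd
  have step (n : ℕ) (y : Q) (hy : f y - b (n + c) ∈ I ^ (n + c) • (⊤ : Submodule A P)) :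
      ∃ y' : Q, f y' - b (n + 1 + c) ∈ I ^ (n + 1 + c) • (⊤ : Submodule A P) ∧
        y' - y ∈ I ^ n • (⊤ : Submodule A Q) := by
    obtain ⟨u, hu⟩ := approx (n + 1 + c)
    have hmem : f (u - y) ∈ I ^ (n + c) • (⊤ : Submodule A P) := by
      have hu' := Submodule.smul_mono_left (N := (⊤ : Submodule A P))
        (Ideal.pow_le_pow_right (I := I) (show n + c ≤ n + 1 + c by lia)) hu
      have hb : b (n + 1 + c) - b (n + c) ∈ I ^ (n + c) • (⊤ : Submodule A P) := by
        rw [← Submodule.Quotient.eq]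
        exact AdicCauchySequence.mk_eq_mk (by lia) b
      have heq : f (u - y) =
          f u - b (n + 1 + c) + (b (n + 1 + c) - b (n + c)) - (f y - b (n + c)) := by
        rw [map_sub]; abel
      rw [heq]
      exact Submodule.sub_mem _ (Submodule.add_mem _ hu' hb) hy
    obtain ⟨d, hd, hdu⟩ := hc (n + c) (by lia) ⟨hmem, _, rfl⟩
    refine ⟨y + d, ?_, by simpa using hd⟩
    have heq : f (y + d) = f u := by rw [map_add, hdu, map_sub, add_sub_cancel]
    rwa [heq]
  choose next hnext hsub using step
  let a : ∀ n : ℕ, {y : Q // f y - b (n + c) ∈ I ^ (n + c) • (⊤ : Submodule A P)} :=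
    fun n ↦ Nat.rec ⟨(approx (0 + c)).choose, (approx (0 + c)).choose_spec⟩
      (fun n y ↦ ⟨next n y.1 y.2, hnext n y.1 y.2⟩) n
  refine ⟨mk I Q (AdicCauchySequence.mk I Q (fun n ↦ (a n).1) fun n ↦ ?_), ?_⟩
  · exact (SModEq.sub_mem.2 (hsub n (a n).1 (a n).2)).symm
  · ext n
    rw [map_mk, mk_apply_coe, mk_apply_coe, Submodule.mkQ_apply, Submodule.mkQ_apply,
      ← AdicCauchySequence.mk_eq_mk (show n ≤ n + c by lia) b, Submodule.Quotient.eq]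
    exact Submodule.smul_mono_left (Ideal.pow_le_pow_right (by lia)) (a n).2

end Exact

section TensorCompletion

variable {A : Type*} [CommRing A] (I : Ideal A) (F : Type*) [AddCommGroup F] [Module A F]
  (M N : Type*) [AddCommGroup M] [Module A M] [AddCommGroup N] [Module A N]

lemma map_add_apply (f g : M →ₗ[A] N) (x : AdicCompletion I M) :
    map I (f + g) x = map I f x + map I g x := by
  obtain ⟨b, rfl⟩ := mk_surjective I M x
  ext n
  simp

lemma map_smul_apply (r : A) (f : M →ₗ[A] N) (x : AdicCompletion I M) :
    map I (r • f) x = r • map I f x := by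
  obtain ⟨b, rfl⟩ := mk_surjective I M x
  ext n
  simp [val_smul_apply]

/-- The functor `AdicCompletion I` on morphisms, as a linear map. -/
noncomputable def mapLinear : (M →ₗ[A] N) →ₗ[A] AdicCompletion I M →ₗ[A] AdicCompletion I N where
  toFun f := (map I f).restrictScalars A
  map_add' f g := LinearMap.ext (map_add_apply I M N f g)
  map_smul' r f := LinearMap.ext (map_smul_apply I M N r f)

/-- The canonical map from `M ⊗ F^∧` to `(M ⊗ F)^∧`. -/
noncomputable def tensorToCompletion :
    M ⊗[A] AdicCompletion I F →ₗ[A] AdicCompletion I (M ⊗[A] F) :=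
  TensorProduct.lift (mapLinear I F (M ⊗[A] F) ∘ₗ TensorProduct.mk A M F)

lemma tensorToCompletion_tmul (m : M) (φ : AdicCompletion I F) :
    tensorToCompletion I F M (m ⊗ₜ φ) = map I (TensorProduct.mk A M F m) φ :=
  rfl

variable {M N} in
lemma tensorToCompletion_naturality (f : M →ₗ[A] N) (t : M ⊗[A] AdicCompletion I F) :
    tensorToCompletion I F N (f.rTensor _ t) =
      map I (f.rTensor F) (tensorToCompletion I F M t) := by
  induction t with
  | zero => simp
  | add a b ha hb => simp only [map_add, ha, hb]
  | tmul m φ =>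
    rw [LinearMap.rTensor_tmul, tensorToCompletion_tmul, tensorToCompletion_tmul, map_comp_apply]
    rfl

lemma tensorToCompletion_bijective_pi (ι : Type*) [Finite ι] :
    Function.Bijective (tensorToCompletion I F (ι → A)) := by
  classical
  cases nonempty_fintype ι
  let coord (i : ι) : (ι → A) ⊗[A] F →ₗ[A] F :=
    (TensorProduct.lid A F).toLinearMap ∘ₗ (LinearMap.proj i).rTensor F
  let inv (z : AdicCompletion I ((ι → A) ⊗[A] F)) : (ι → A) ⊗[A] AdicCompletion I F :=
    ∑ i, Pi.single i 1 ⊗ₜ mapLinear I _ _ (coord i) z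
  have inv_add (x y) : inv (x + y) = inv x + inv y := by
    simp only [inv, map_add, TensorProduct.tmul_add, Finset.sum_add_distrib]
  refine Function.bijective_iff_has_inverse.2 ⟨inv, fun t ↦ ?_, fun z ↦ ?_⟩
  · induction t with
    | zero => simp [inv]
    | add a b ha hb => rw [map_add, inv_add, ha, hb]
    | tmul m φ =>
      have h (i : ι) : mapLinear I _ _ (coord i) (tensorToCompletion I F (ι → A) (m ⊗ₜ φ)) =
          m i • φ := by
        have hcomp : coord i ∘ₗ TensorProduct.mk A (ι → A) F m = m i • LinearMap.id := by
          ext x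
          simp [coord]
        change map I (coord i) (map I _ φ) = _
        rw [map_comp_apply, hcomp, map_smul_apply, map_id, LinearMap.id_apply]
      simp only [inv, h, ← TensorProduct.smul_tmul, ← TensorProduct.sum_tmul]
      congr 1
      ext j
      simp [Pi.single_apply]
  · have hsum : ∑ i, TensorProduct.mk A (ι → A) F (Pi.single i 1) ∘ₗ coord i =
        LinearMap.id := by
      ext i x
      have hcoord (j : ι) : coord j (Pi.single i 1 ⊗ₜ x) = (Pi.single i 1 : ι → A) j • x := rfl
      simp [hcoord, Pi.single_apply, TensorProduct.tmul_ite]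
    have h (i : ι) : tensorToCompletion I F (ι → A)
        (Pi.single i 1 ⊗ₜ mapLinear I _ _ (coord i) z) =
          mapLinear I _ _ (TensorProduct.mk A (ι → A) F (Pi.single i 1) ∘ₗ coord i) z :=
      map_comp_apply I _ _ z
    simp only [inv, map_sum, h]
    rw [← LinearMap.sum_apply, ← map_sum, hsum]
    exact congrArg (· z) (map_id I _)

end TensorCompletion

end AdicCompletion

lemma AdicCompletion.tensorToCompletion_bijective {A : Type u} [CommRing A] (I : Ideal A)
    (hAPf : APf I) (F : Type*) [AddCommGroup F] [Module A F] [Module.Flat A F]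
    (M : Type*) [AddCommGroup M] [Module A M] [Module.FinitePresentation A M] :
    Function.Bijective (tensorToCompletion I F M) := by
  obtain ⟨n, m, g, f, hg, hfg⟩ := Module.FinitePresentation.exists_fin' A M
  obtain ⟨c, hc⟩ := hAPf (Fin n → A) inferInstance (LinearMap.range f)
    (Module.Finite.iff_fg.1 inferInstance)
  have hP := tensorToCompletion_bijective_pi I F (Fin n)
  have hQ := tensorToCompletion_bijective_pi I F (Fin m)
  have hexact := rTensor_exact F hfg hg
  have hexact' := rTensor_exact (AdicCompletion I F) hfg hg
  constructor
  · rw [injective_iff_map_eq_zero]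
    intro t ht
    obtain ⟨s, rfl⟩ := LinearMap.rTensor_surjective _ hg t
    rw [tensorToCompletion_naturality] at ht
    obtain ⟨w, hw⟩ := exists_map_eq_of_map_eq_zero I _ _ hexact
      (LinearMap.rTensor_surjective F hg) c (fun k hk ↦
        Module.Flat.smul_top_inf_range_rTensor_le f _ _ (by
          rw [hc k hk, Submodule.map_smul'', Submodule.map_top]
          exact smul_mono_right _ inf_le_left)) _ ht
    obtain ⟨w, rfl⟩ := hQ.2 w
    rw [← tensorToCompletion_naturality] at hw
    rw [← hP.1 hw]
    exact hexact'.apply_apply_eq_zero w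
  · intro z
    obtain ⟨y, rfl⟩ := map_surjective I (LinearMap.rTensor_surjective F hg) z
    obtain ⟨s, rfl⟩ := hP.2 y
    exact ⟨g.rTensor _ s, tensorToCompletion_naturality I F g s⟩

open TensorProduct in
/-- Let `A` be `I`-adically complete for a finitely generated
ideal `I` satisfying (APf), and let `F` be a flat `A`-module. Then for every
finitely presented `A`-module `M`, the canonical map
`M ⊗_A F^∧ → (M ⊗_A F)^∧` is an isomorphism (`(-)^∧` is `I`-adic completion).
The canonical map is characterized on pure tensors by
`m ⊗ φ ↦ (image of m ⊗ x_n)_n` for lifts `x_n` of the components of `φ`. -/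
theorem stmt17 {A : Type u} [CommRing A] (I : Ideal A) (hfg : I.FG)
    (hcomplete : IsAdicComplete I A) (hAPf : APf I)
    (F : Type u) [AddCommGroup F] [Module A F] (hF : Module.Flat A F)
    (M : Type u) [AddCommGroup M] [Module A M]
    (hM : Module.FinitePresentation A M) :
    ∃ e : (M ⊗[A] AdicCompletion I F) ≃ₗ[A] AdicCompletion I (M ⊗[A] F),
      ∀ (m : M) (φ : AdicCompletion I F) (n : ℕ) (x : F),
        AdicCompletion.eval I F n φ = Submodule.Quotient.mk x →
        AdicCompletion.eval I (M ⊗[A] F) n (e (m ⊗ₜ[A] φ)) =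
          Submodule.Quotient.mk (m ⊗ₜ[A] x) := by
  refine ⟨LinearEquiv.ofBijective _ (AdicCompletion.tensorToCompletion_bijective I hAPf F M),
    fun m φ n x hx ↦ ?_⟩
  change (AdicCompletion.map I (TensorProduct.mk A M F m) φ).val n = _
  rw [AdicCompletion.eval_apply] at hx
  rw [AdicCompletion.map_val_apply, hx]
  rfl
end

section
/- Let A be a commutative ring and I ⊆ A a finitely generated ideal such that A is I-adically complete and the pair (A, I) satisfies the Artin–Rees type condition (APf): for every finitely generated A-module M and every finitely generated A-submodule N ⊆ M, the filtration {N ∩ I^n M}_{n≥0} is I-adic, i.e., there exists c ≥ 0 with N ∩ I^n M = I^{n-c}(N ∩ I^c M) for all n ≥ c. If F is a flat (respectively, faithfully flat) A-module, then its I-adic completion F^∧ is a flat (respectively, faithfully flat) A-module. -/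
universe u

section Lemmas

variable {A : Type u} [CommRing A] {I : Ideal A}

theorem Submodule.exists_eq_sum_of_forall_mem_smul_top {M : Type*} [AddCommGroup M] [Module A M]
    {U : Ideal A} {m : ℕ} {y : Fin m → M} (hy : ∀ i, y i ∈ U • (⊤ : Submodule A M)) :
    ∃ (k : ℕ) (b : Fin m → Fin k → A) (w : Fin k → M),
      (∀ i l, b i l ∈ U) ∧ ∀ i, y i = ∑ l, b i l • w l := by
  classical
  have h (i) : ∃ (b : M →₀ A) (_ : ∀ w, b w ∈ U), (b.sum fun w c => c • w) = y i := by
    rw [← Submodule.mem_ideal_smul_span_iff_exists_sum U (fun w : M => w)]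
    simpa using hy i
  choose b hb hby using h
  let S : Finset M := Finset.univ.biUnion fun i => (b i).support
  refine ⟨S.card, fun i l => b i (S.equivFin.symm l), fun l => S.equivFin.symm l,
    fun i l => hb i _, fun i => ?_⟩
  rw [← hby i, Finsupp.sum_of_support_subset (s := S) _ _ _ (by simp),
    S.equivFin.symm.sum_comp (fun w : S => b i w • (w : M)), Finset.sum_coe_sort S fun w => b i w • w]
  intro w hw
  exact Finset.mem_biUnion.2 ⟨i, Finset.mem_univ _, hw⟩

theorem Submodule.mem_smul_top_pi_iff {m : ℕ} {U : Ideal A} {p : Fin m → A} :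
    p ∈ U • (⊤ : Submodule A (Fin m → A)) ↔ ∀ i, p i ∈ U := by
  constructor
  · intro hp i
    have := Submodule.mem_map_of_mem (f := LinearMap.proj (R := A) (φ := fun _ => A) i) hp
    rw [Submodule.map_smul''] at this
    simpa using SetLike.le_def.1 (smul_mono_right U le_top) this
  · intro hp
    rw [pi_eq_sum_univ' p]
    exact Submodule.sum_mem _ fun i _ => Submodule.smul_mem_smul (hp i) trivial

/-- Solutions in a flat module of a linear equation modulo an ideal `V`, with entries in an
ideal `U`, come from such solutions over the base ring. -/
theorem Module.Flat.exists_eq_sum_of_sum_smul_mem {F : Type*} [AddCommGroup F] [Module A F]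
    [Module.Flat A F] {U V : Ideal A} {m : ℕ} {a : Fin m → A} {y : Fin m → F}
    (hy : ∀ i, y i ∈ U • (⊤ : Submodule A F))
    (hay : ∑ i, a i • y i ∈ V • (⊤ : Submodule A F)) :
    ∃ (k : ℕ) (p : Fin k → Fin m → A) (v : Fin k → F), (∀ j i, p j i ∈ U) ∧
      (∀ j, ∑ i, a i * p j i ∈ V) ∧ ∀ i, y i = ∑ j, p j i • v j := by
  obtain ⟨r, b, w, hb, hyb⟩ := Submodule.exists_eq_sum_of_forall_mem_smul_top hy
  obtain ⟨s, d, u, hd, hyd⟩ := Submodule.exists_eq_sum_of_forall_mem_smul_top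
    (y := fun _ : Fin 1 => ∑ i, a i • y i) fun _ => hay
  have hrel : ∑ t, (Sum.elim (fun l => ∑ i, a i * b i l) (fun l => -d 0 l) : Fin r ⊕ Fin s → A) t •
      (Sum.elim w u t) = 0 := by
    have h := hyd 0
    simp only [hyb, Finset.smul_sum, smul_smul] at h
    rw [Finset.sum_comm] at h
    simp [Fintype.sum_sum_type, Finset.sum_smul, h]
  obtain ⟨k, q, v, hq, hq0⟩ := Module.Flat.isTrivialRelation_of_sum_smul_eq_zero hrel
  refine ⟨k, fun j i => ∑ l, b i l * q (.inl l) j, v, fun j i => ?_, fun j => ?_, fun i => ?_⟩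
  · exact Ideal.sum_mem _ fun l _ => Ideal.mul_mem_right _ _ (hb i l)
  · have h := hq0 j
    simp only [Fintype.sum_sum_type, Sum.elim_inl, Sum.elim_inr, neg_mul, Finset.sum_neg_distrib,
      ← sub_eq_add_neg, sub_eq_zero, Finset.sum_mul] at h
    rw [Finset.sum_comm] at h
    simp only [Finset.mul_sum, ← mul_assoc]
    rw [h]
    exact Ideal.sum_mem _ fun l _ => Ideal.mul_mem_right _ _ (hd 0 l)
  · have hw (l) : w l = ∑ j, q (.inl l) j • v j := hq (.inl l)
    simp only [hyb, hw, Finset.smul_sum, Finset.sum_smul, smul_smul]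
    exact Finset.sum_comm

theorem APf.exists_eq_sum (hI : APf I) {M : Type u} [AddCommGroup M] [Module A M]
    [Module.Finite A M] {m : ℕ} (f : Fin m → M) :
    ∃ c : ℕ, ∀ n : ℕ, ∀ x ∈ Submodule.span A (Set.range f), x ∈ I ^ n • (⊤ : Submodule A M) →
      ∃ s : Fin m → A, (∀ l, s l ∈ I ^ (n - c)) ∧ x = ∑ l, s l • f l := by
  obtain ⟨c, hc⟩ := hI M inferInstance (Submodule.span A (Set.range f))
    (Submodule.fg_span (Set.finite_range f))
  refine ⟨c, fun n x hx hxn => ?_⟩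
  have hmem : x ∈ I ^ (n - c) • Submodule.span A (Set.range f) := by
    rcases le_total c n with h | h
    · exact SetLike.le_def.1 (smul_mono_right _ inf_le_left) ((hc n h).le ⟨hx, hxn⟩)
    · simpa [Nat.sub_eq_zero_of_le h] using hx
  obtain ⟨s, hs, rfl⟩ := (Submodule.mem_ideal_smul_span_iff_exists_sum _ _ _).1 hmem
  exact ⟨s, hs, Finsupp.sum_fintype _ _ (by simp)⟩

theorem APf.isHausdorff [IsAdicComplete I A] (hI : APf I) (M : Type u) [AddCommGroup M]
    [Module A M] [Module.Finite A M] : IsHausdorff I M := by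
  refine ⟨fun x hx => ?_⟩
  simp only [SModEq.zero] at hx
  have hfg : (Submodule.span A {x}).FG := Submodule.fg_span_singleton x
  obtain ⟨c, hc⟩ := hI M inferInstance _ hfg
  have hle : Submodule.span A {x} ≤ I • Submodule.span A {x} := by
    rw [Submodule.span_singleton_le_iff_mem]
    have := (hc (c + 1) (by lia)).le ⟨Submodule.mem_span_singleton_self x, hx _⟩
    rw [Nat.add_sub_cancel_left, pow_one] at this
    exact SetLike.le_def.1 (smul_mono_right _ inf_le_left) this
  simpa using Submodule.eq_bot_of_le_smul_of_le_jacobson_bot I _ hfg hle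
    (IsAdicComplete.le_jacobson_bot I)

/-- Every submodule of a finite module is closed in the `I`-adic topology. -/
theorem APf.mem_of_forall_mem_sup [IsAdicComplete I A] (hI : APf I) {M : Type u} [AddCommGroup M]
    [Module A M] [Module.Finite A M] (L : Submodule A M) {x : M}
    (hx : ∀ n, x ∈ L ⊔ I ^ n • (⊤ : Submodule A M)) : x ∈ L := by
  have := hI.isHausdorff (M ⧸ L)
  rw [← Submodule.Quotient.mk_eq_zero]
  refine IsHausdorff.haus this _ fun n => ?_
  rw [SModEq.zero]
  obtain ⟨l, hl, z, hz, rfl⟩ := Submodule.mem_sup.1 (hx n)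
  have h := Submodule.mem_map_of_mem (f := L.mkQ) hz
  rw [Submodule.map_smul''] at h
  rw [Submodule.Quotient.mk_add, (Submodule.Quotient.mk_eq_zero L).2 hl, zero_add]
  exact SetLike.le_def.1 (smul_mono_right _ le_top) h

theorem IsPrecomplete.pi_fin [IsPrecomplete I A] (m : ℕ) : IsPrecomplete I (Fin m → A) := by
  refine ⟨fun f hf => ?_⟩
  simp only [SModEq.sub_mem, Submodule.mem_smul_top_pi_iff] at hf ⊢
  have h (i : Fin m) : ∃ L : A, ∀ n, f n i ≡ L [SMOD (I ^ n • ⊤ : Submodule A A)] :=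
    IsPrecomplete.prec ‹_› fun hmn => by simpa [SModEq.sub_mem] using hf hmn i
  choose L hL using h
  exact ⟨L, fun n i => by simpa [SModEq.sub_mem] using hL i n⟩

/-- A Baire category argument: a sequence of finitely generated submodules converging to zero
generates a finitely generated submodule. -/
theorem APf.fg_iSup [IsAdicComplete I A] (hI : APf I) {M : Type u} [AddCommGroup M]
    [Module A M] [Module.Finite A M] [IsPrecomplete I M] (P : ℕ → Submodule A M)
    (hP : ∀ n, (P n).FG) (hPI : ∀ n, P n ≤ I ^ n • ⊤) : (⨆ n, P n).FG := by
  by_contra hfg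
  let L (n : ℕ) : Submodule A M := ⨆ i ∈ Finset.range n, P i
  have hL (n) : (L n).FG := Submodule.fg_biSup _ _ fun i _ => hP i
  have hPL {i n : ℕ} (h : i < n) : P i ≤ L n :=
    le_biSup P (Finset.mem_range.2 h)
  have hLmono : Monotone L := fun a b hab =>
    iSup₂_le fun i hi => hPL ((Finset.mem_range.1 hi).trans_le hab)
  have hLP (n) : L n ≤ ⨆ n, P n := iSup₂_le fun i _ => le_iSup P i
  have hex (n e : ℕ) : ∃ t, e ≤ t ∧ ¬ P t ≤ L n := by
    by_contra! h
    have heq : ⨆ n, P n = L (max n e) := by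
      refine le_antisymm (iSup_le fun t => ?_) (hLP _)
      rcases lt_or_ge t e with ht | ht
      · exact hPL (ht.trans_le (le_max_right _ _))
      · exact (h t ht).trans (hLmono (le_max_left _ _))
    exact hfg (heq ▸ hL _)
  have hsep (n N : ℕ) (z : M) (hz : z ∉ L n) :
      ∃ e, N ≤ e ∧ z ∉ L n ⊔ I ^ e • (⊤ : Submodule A M) := by
    by_contra! h
    refine hz (hI.mem_of_forall_mem_sup _ fun k => ?_)
    refine SetLike.le_def.1 (sup_le_sup_left ?_ _) (h (max N k) (le_max_left _ _))
    exact Submodule.smul_mono_left (Ideal.pow_le_pow_right (le_max_right N k))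
  have hstep (j e : ℕ) (z : M) (hz : z ∈ ⨆ n, P n) : ∃ (z' : M) (e' : ℕ), z' ∈ ⨆ n, P n ∧
      z' - z ∈ I ^ e • (⊤ : Submodule A M) ∧ e < e' ∧
      z' ∉ L j ⊔ I ^ e' • (⊤ : Submodule A M) := by
    obtain ⟨z', hz', hzz', hz'L⟩ : ∃ z' ∈ ⨆ n, P n,
        z' - z ∈ I ^ e • (⊤ : Submodule A M) ∧ z' ∉ L j := by
      by_cases hzL : z ∈ L j
      · obtain ⟨t, het, ht⟩ := hex j e
        obtain ⟨p, hp, hpL⟩ := SetLike.not_le_iff_exists.1 ht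
        refine ⟨z + p, add_mem hz (le_iSup P t hp), ?_, fun h => hpL ?_⟩
        · rw [add_sub_cancel_left]
          exact Submodule.smul_mono_left (Ideal.pow_le_pow_right het) (hPI t hp)
        · simpa using sub_mem h hzL
      · exact ⟨z, hz, by simp, hzL⟩
    obtain ⟨e', he', h⟩ := hsep j (e + 1) z' hz'L
    exact ⟨z', e', hz', hzz', he', h⟩
  choose! nz ne hnz hnzz hne hnL using hstep
  let s : ℕ → M × ℕ := fun j => Nat.rec (0, 0) (fun j s => (nz j s.2 s.1, ne j s.2 s.1)) j
  have hs (j) : s (j + 1) = (nz j (s j).2 (s j).1, ne j (s j).2 (s j).1) := rfl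
  have hsP (j) : (s j).1 ∈ ⨆ n, P n := by
    induction j with
    | zero => exact zero_mem _
    | succ j ih => rw [hs]; exact hnz _ _ _ ih
  have hse : StrictMono fun j => (s j).2 := strictMono_nat_of_lt_succ fun j => by
    rw [hs]; exact hne _ _ _ (hsP j)
  have hsub {j k : ℕ} (hjk : j ≤ k) : (s k).1 - (s j).1 ∈ I ^ (s j).2 • (⊤ : Submodule A M) := by
    induction k, hjk using Nat.le_induction with
    | base => simp
    | succ k hjk ih =>
      rw [← sub_add_sub_cancel _ (s k).1]
      refine add_mem ?_ ih
      rw [hs]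
      exact Submodule.smul_mono_left (Ideal.pow_le_pow_right (hse.monotone hjk))
        (hnzz k _ _ (hsP k))
  obtain ⟨y, hy⟩ := IsPrecomplete.prec ‹IsPrecomplete I M› (f := fun j => (s j).1)
    fun {j k} hjk => by
      rw [SModEq.comm, SModEq.sub_mem]
      exact Submodule.smul_mono_left (Ideal.pow_le_pow_right (hse.le_apply)) (hsub hjk)
  simp only [SModEq.sub_mem] at hy
  have hys (j) : (s j).1 - y ∈ I ^ (s j).2 • (⊤ : Submodule A M) := by
    rw [← sub_sub_sub_cancel_left _ _ (s (s j).2).1, ← neg_mem_iff, neg_sub]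
    refine sub_mem (hsub hse.le_apply) ?_
    simpa using hy (s j).2
  have hyP : y ∈ ⨆ n, P n := hI.mem_of_forall_mem_sup _ fun n => by
    rw [← sub_sub_cancel (s n).1 y]
    exact sub_mem (Submodule.mem_sup_left (hsP n)) (Submodule.mem_sup_right (hy n))
  have hyL : ∃ n, y ∈ L n := by
    have : ⨆ n, P n ≤ ⨆ n, L n := iSup_mono' fun n => ⟨n + 1, hPL n.lt_succ_self⟩
    exact (Submodule.mem_iSup_of_directed L hLmono.directed_le).1 (this hyP)
  obtain ⟨n, hn⟩ := hyL
  apply hnL n (s n).2 (s n).1 (hsP n)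
  have h := hys (n + 1)
  rw [hs] at h
  rw [← sub_add_cancel (nz n (s n).2 (s n).1) y]
  exact add_mem (Submodule.mem_sup_right h) (Submodule.mem_sup_left hn)

theorem AdicCompletion.eval_eq_mkQ_of_le {F : Type*} [AddCommGroup F] [Module A F]
    {x : AdicCompletion I F} {y : F} {n k : ℕ} (hnk : n ≤ k)
    (h : AdicCompletion.eval I F k x = Submodule.mkQ (I ^ k • (⊤ : Submodule A F)) y) :
    AdicCompletion.eval I F n x = Submodule.mkQ (I ^ n • (⊤ : Submodule A F)) y := by
  rw [AdicCompletion.eval_apply] at h ⊢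
  rw [← AdicCompletion.transitionMap_comp_eval_apply I F hnk x, h]
  rfl

/-- Relations in the completion of a flat module are approximated by relations in the module. -/
theorem APf.exists_approx_relation (hI : APf I) {F : Type u} [AddCommGroup F] [Module A F]
    [Module.Flat A F] {m : ℕ} {a : Fin m → A} {x : Fin m → AdicCompletion I F}
    (hax : ∑ i, a i • x i = 0) (n : ℕ) :
    ∃ z : Fin m → F, ∑ i, a i • z i = 0 ∧ ∀ i, AdicCompletion.eval I F n (x i) =
      Submodule.mkQ (I ^ n • (⊤ : Submodule A F)) (z i) := by
  obtain ⟨c, hc⟩ := hI.exists_eq_sum a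
  choose y hy using fun i => Submodule.mkQ_surjective (I ^ (n + c) • (⊤ : Submodule A F))
    (AdicCompletion.eval I F (n + c) (x i))
  have hay : ∑ i, a i • y i ∈ I ^ (n + c) • (⊤ : Submodule A F) := by
    rw [← Submodule.Quotient.mk_eq_zero, ← Submodule.mkQ_apply]
    simp only [map_sum, map_smul, hy]
    simp only [← map_smul, ← map_sum, hax, map_zero]
  obtain ⟨k, p, v, -, hap, hyp⟩ := Module.Flat.exists_eq_sum_of_sum_smul_mem
    (U := ⊤) (y := y) (by simp) hay
  have hq (j) : ∃ q : Fin m → A, (∀ i, q i ∈ I ^ n) ∧ ∑ i, a i * p j i = ∑ i, q i * a i := by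
    have := hc (n + c) (∑ i, a i * p j i)
      (sum_mem fun i _ => mul_comm (a i) (p j i) ▸
        Submodule.smul_mem _ (p j i) (Submodule.subset_span ⟨i, rfl⟩))
      (by simpa using hap j)
    simpa using this
  choose q hq hpq using hq
  refine ⟨fun i => ∑ j, (p j i - q j i) • v j, ?_, fun i => ?_⟩
  · simp only [Finset.smul_sum, smul_smul]
    rw [Finset.sum_comm]
    refine Finset.sum_eq_zero fun j _ => ?_
    rw [← Finset.sum_smul]
    simp only [mul_sub, Finset.sum_sub_distrib, hpq]
    simp [mul_comm]
  · rw [AdicCompletion.eval_eq_mkQ_of_le (Nat.le_add_right n c) (hy i).symm, ← sub_eq_zero, ← map_sub, Submodule.mkQ_apply, Submodule.Quotient.mk_eq_zero, hyp,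
      ← Finset.sum_sub_distrib]
    refine sum_mem fun j _ => ?_
    rw [← sub_smul, sub_sub_cancel]
    exact Submodule.smul_mem_smul (hq j i) trivial

theorem APf.flat_adicCompletion [IsAdicComplete I A] (hI : APf I) (F : Type u) [AddCommGroup F]
    [Module A F] [Module.Flat A F] : Module.Flat A (AdicCompletion I F) := by
  refine Module.Flat.of_forall_isTrivialRelation fun {m a x} hax => ?_
  have hz (n : ℕ) : ∃ z : Fin m → F, ∑ i, a i • z i = 0 ∧ (∀ i, AdicCompletion.eval I F n (x i) =
      Submodule.mkQ (I ^ n • (⊤ : Submodule A F)) (z i)) ∧ (n = 0 → z = 0) := by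
    rcases eq_or_ne n 0 with rfl | hn
    · have : Subsingleton (F ⧸ (I ^ 0 • (⊤ : Submodule A F))) :=
        Submodule.Quotient.subsingleton_iff.2 (by simp)
      exact ⟨0, by simp, fun i => Subsingleton.elim _ _, fun _ => rfl⟩
    · obtain ⟨z, hz, hxz⟩ := hI.exists_approx_relation hax n
      exact ⟨z, hz, hxz, fun h => absurd h hn⟩
  choose z haz hxz hz0 using hz
  have hz0 : z 0 = 0 := hz0 0 rfl
  have hd (n : ℕ) (i) : z (n + 1) i - z n i ∈ I ^ n • (⊤ : Submodule A F) := by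
    rw [← Submodule.Quotient.mk_eq_zero, ← Submodule.mkQ_apply, map_sub, ← hxz n,
      AdicCompletion.eval_eq_mkQ_of_le n.le_succ (hxz (n + 1) i), sub_self]
  have hk (n : ℕ) := Module.Flat.exists_eq_sum_of_sum_smul_mem (U := I ^ n) (V := ⊥) (a := a)
    (y := fun i => z (n + 1) i - z n i) (hd n)
    (by simp [smul_sub, Finset.sum_sub_distrib, haz])
  choose k p v hp hap hzp using hk
  have := IsPrecomplete.pi_fin (I := I) m
  let P (n : ℕ) : Submodule A (Fin m → A) := Submodule.span A (Set.range (p n))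
  have hPfg : (⨆ n, P n).FG := hI.fg_iSup P (fun n => Submodule.fg_span (Set.finite_range _))
    fun n => Submodule.span_le.2 <| Set.range_subset_iff.2 fun j =>
      Submodule.mem_smul_top_pi_iff.2 (hp n j)
  obtain ⟨r, κ, hκ⟩ := Submodule.fg_iff_exists_fin_generating_family.1 hPfg
  have hPa : ⨆ n, P n ≤ LinearMap.ker (Fintype.linearCombination A a) :=
    iSup_le fun n => Submodule.span_le.2 <| Set.range_subset_iff.2 fun j => by
      simpa [Fintype.linearCombination_apply, mul_comm] using hap n j
  obtain ⟨c, hc⟩ := hI.exists_eq_sum κ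
  have hs (n j) := hc n (p n j)
    (hκ ▸ le_iSup P n (Submodule.subset_span ⟨j, rfl⟩)) (Submodule.mem_smul_top_pi_iff.2 (hp n j))
  choose s hs hps using hs
  let g (n : ℕ) (l : Fin r) : F := ∑ j, s n j l • v n j
  have hg (n l) : g n l ∈ I ^ (n - c) • (⊤ : Submodule A F) :=
    sum_mem fun j _ => Submodule.smul_mem_smul (hs n j l) trivial
  have hzg (n i) : z n i = ∑ l, κ l i • ∑ t ∈ Finset.range n, g t l := by
    induction n with
    | zero => simp [hz0]
    | succ n ih =>
      rw [← sub_add_cancel (z (n + 1) i) (z n i), hzp n i, ih]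
      simp only [Finset.sum_range_succ, smul_add, Finset.sum_add_distrib]
      rw [add_comm]
      congr 1
      simp only [g, hps, Finset.sum_apply, Pi.smul_apply, smul_eq_mul, Finset.sum_smul,
        Finset.smul_sum, smul_smul]
      rw [Finset.sum_comm]
      simp only [mul_comm]
  let γ (l : Fin r) : AdicCompletion I F := AdicCompletion.mk I F <|
    AdicCompletion.AdicCauchySequence.mk I F (fun n => ∑ t ∈ Finset.range (n + c), g t l) fun n => by
      rw [SModEq.comm, SModEq.sub_mem, Nat.add_right_comm, Finset.sum_range_succ,
        add_sub_cancel_left]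
      simpa using hg (n + c) l
  refine ⟨r, fun i l => κ l i, γ, fun i => ?_, fun l => ?_⟩
  · refine AdicCompletion.ext fun n => ?_
    rw [← AdicCompletion.eval_apply, ← AdicCompletion.eval_apply,
      AdicCompletion.eval_eq_mkQ_of_le (Nat.le_add_right n c) (hxz (n + c) i), hzg, map_sum,
      map_sum]
    rfl
  · have : κ l ∈ ⨆ n, P n := hκ ▸ Submodule.subset_span ⟨l, rfl⟩
    simpa [Fintype.linearCombination_apply, mul_comm] using hPa this

theorem AdicCompletion.smul_top_ne_top {F : Type*} [AddCommGroup F] [Module A F] {J : Ideal A}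
    (hIJ : I ≤ J) (hJ : J • (⊤ : Submodule A F) ≠ ⊤) :
    J • (⊤ : Submodule A (AdicCompletion I F)) ≠ ⊤ := by
  intro h
  apply hJ
  have h1 := congrArg (Submodule.map (AdicCompletion.eval I F 1)) h
  rw [Submodule.map_smul'', Submodule.map_top, AdicCompletion.range_eval,
    ← Submodule.range_mkQ, ← Submodule.map_top, ← Submodule.map_smul''] at h1
  have h2 := congrArg (Submodule.comap (Submodule.mkQ (I ^ 1 • (⊤ : Submodule A F)))) h1
  rw [Submodule.comap_map_mkQ, Submodule.comap_map_mkQ, pow_one, sup_top_eq] at h2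
  rwa [sup_eq_right.2 (Submodule.smul_mono_left hIJ)] at h2

end Lemmas

/-- Let `A` be `I`-adically complete for a finitely generated
ideal `I` satisfying (APf). If `F` is a flat (resp. faithfully flat) `A`-module,
then its `I`-adic completion `F^∧` is a flat (resp. faithfully flat)
`A`-module. -/
theorem stmt18 {A : Type u} [CommRing A] (I : Ideal A) (hfg : I.FG)
    (hcomplete : IsAdicComplete I A) (hAPf : APf I)
    (F : Type u) [AddCommGroup F] [Module A F] :
    (Module.Flat A F → Module.Flat A (AdicCompletion I F)) ∧
    (Module.FaithfullyFlat A F → Module.FaithfullyFlat A (AdicCompletion I F)) := by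
  refine ⟨fun _ => hAPf.flat_adicCompletion F, fun hF => ?_⟩
  have := hF.toFlat
  have := hAPf.flat_adicCompletion F
  refine ⟨fun J hJ => AdicCompletion.smul_top_ne_top ?_ (hF.submodule_ne_top hJ)⟩
  exact (IsAdicComplete.le_jacobson_bot I).trans (sInf_le ⟨bot_le, hJ⟩)
end
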